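/- arXiv:1407.7834 — 2 statements merged into one kernel-verified Lean document; each statement's English description precedes it below -/
import Mathlib

section
/- Let r ≥ 2 and let F be the free group of rank r. The set of full elements of F is exponentially generic in F. -/
namespace VG

variable {r : ℕ}

/-- Word length: the length of the unique freely reduced word representing `w`. -/
def len (w : FreeGroup (Fin r)) : ℕ := (FreeGroup.toWord w).length

/-- The number of elements of `A` of word length at most `n`. -/
noncomputable def ballCount (A : Set (FreeGroup (Fin r))) (n : ℕ) : ℕ :=
  {w | w ∈ A ∧ len w ≤ n}.ncard

/-- The number of elements of `A` of word length exactly `n`. -/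
noncomputable def sphereCount (A : Set (FreeGroup (Fin r))) (n : ℕ) : ℕ :=
  {w | w ∈ A ∧ len w = n}.ncard

/-- `A` is exponentially generic in `B`: there are `a > 0` and `b` such that, for all
sufficiently large `n`, the proportion of elements of `B` of length at most `n` lying
in `A` is at least `1 - exp (b - a n)`. -/
def ExpGeneric (A B : Set (FreeGroup (Fin r))) : Prop :=
  ∃ a : ℝ, 0 < a ∧ ∃ b : ℝ, ∃ N : ℕ, ∀ n : ℕ, N ≤ n →
    (1 : ℝ) - Real.exp (b - a * n) ≤ (ballCount A n : ℝ) / (ballCount B n)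

/-- `A` is exponentially rare in `B` if its complement in `B` is exponentially generic. -/
def ExpRare (A B : Set (FreeGroup (Fin r))) : Prop := ExpGeneric (B \ A) B

/-- `v` is a subword of `w`: the reduced word of `v` is a contiguous sublist of that of `w`. -/
def Subword (v w : FreeGroup (Fin r)) : Prop :=
  FreeGroup.toWord v <:+: FreeGroup.toWord w

/-- `w` is cyclically reduced: the first letter of its reduced word is not the inverse of
the last letter. -/
def CyclicallyReduced (w : FreeGroup (Fin r)) : Prop :=
  ∀ a ∈ (FreeGroup.toWord w).head?, ∀ b ∈ (FreeGroup.toWord w).getLast?,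
    a ≠ (b.1, !b.2)

/-- `c` is the cyclic reduction of `w`: it is cyclically reduced and conjugate to `w`. -/
def IsCyclicReduction (c w : FreeGroup (Fin r)) : Prop :=
  CyclicallyReduced c ∧ ∃ g : FreeGroup (Fin r), w = g * c * g⁻¹

/-- Middle third of a list: delete the first and last `⌈l/3⌉` entries. -/
def middleThird {α : Type*} (l : List α) : List α :=
  (l.drop ((l.length + 2) / 3)).take (l.length - 2 * ((l.length + 2) / 3))

/-- `v` is cyclically contained in `w` if the reduced word of `v` is a subword of some
positive power of the cyclic reduction of `w`. -/
def CyclicallyContains (w v : FreeGroup (Fin r)) : Prop :=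
  ∃ c : FreeGroup (Fin r), IsCyclicReduction c w ∧ ∃ k : ℕ, 1 ≤ k ∧ Subword v (c ^ k)

/-- `w` is full: every freely reduced word of length 3, or its inverse, is cyclically
contained in `w`. -/
def Full (w : FreeGroup (Fin r)) : Prop :=
  ∀ t : FreeGroup (Fin r), len t = 3 → CyclicallyContains w t ∨ CyclicallyContains w t⁻¹

/-- The group element corresponding to a single letter. -/
def letterElem (a : Fin r × Bool) : FreeGroup (Fin r) := FreeGroup.mk [a]

/-- The inverse of a letter. -/
def linv (a : Fin r × Bool) : Fin r × Bool := (a.1, !a.2)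

/-- `w` is a proper power: `w = u^k` for some `k ≥ 2`. -/
def ProperPower (w : FreeGroup (Fin r)) : Prop :=
  ∃ u : FreeGroup (Fin r), ∃ k : ℕ, 2 ≤ k ∧ w = u ^ k

/-- Minimal word length in the conjugacy class of `w`. -/
noncomputable def conjMinLen (w : FreeGroup (Fin r)) : ℕ :=
  sInf (len '' {u | IsConj u w})

/-- `w` is Whitehead minimal: for every automorphism `α` of the free group, the length of
`w` is at most the minimal length of an element conjugate to `α w`. -/
def WhiteheadMinimal (w : FreeGroup (Fin r)) : Prop :=
  ∀ α : FreeGroup (Fin r) ≃* FreeGroup (Fin r), len w ≤ conjMinLen (α w)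


noncomputable instance decRed (L : List (Fin r × Bool)) : Decidable (FreeGroup.IsReduced L) :=
  Classical.propDecidable _

theorem card_biUnion_le_real {ι β : Type*} [DecidableEq β] (s : Finset ι) (f : ι → Finset β)
    (K : ℝ) (h : ∀ a ∈ s, ((f a).card : ℝ) ≤ K) : ((s.biUnion f).card : ℝ) ≤ s.card * K := by
  have h1 : ((s.biUnion f).card : ℝ) ≤ ∑ a ∈ s, ((f a).card : ℝ) := by
    exact_mod_cast Finset.card_biUnion_le
  refine h1.trans ((Finset.sum_le_sum h).trans ?_)
  rw [Finset.sum_const, nsmul_eq_mul]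

/-- Extensions by one letter on the left. -/
noncomputable def extS (S : Finset (List (Fin r × Bool))) : Finset (List (Fin r × Bool)) :=
  ((S ×ˢ (Finset.univ : Finset (Fin r × Bool))).filter
    (fun p : List (Fin r × Bool) × (Fin r × Bool) => FreeGroup.IsReduced (p.2 :: p.1))).image (fun p => p.2 :: p.1)

theorem mem_extS {S : Finset (List (Fin r × Bool))} {L : List (Fin r × Bool)} :
    L ∈ extS S ↔ ∃ a w, L = a :: w ∧ w ∈ S ∧ FreeGroup.IsReduced (a :: w) := by
  simp only [extS, Finset.mem_image, Finset.mem_filter, Finset.mem_product, Finset.mem_univ,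
    and_true]
  constructor
  · rintro ⟨⟨w, a⟩, ⟨h1, h2⟩, rfl⟩
    exact ⟨a, w, rfl, h1, h2⟩
  · rintro ⟨a, w, rfl, h1, h2⟩
    exact ⟨(w, a), ⟨h1, h2⟩, rfl⟩

theorem card_extS (S : Finset (List (Fin r × Bool))) :
    (extS S).card = ∑ w ∈ S, (Finset.univ.filter
      (fun a : Fin r × Bool => FreeGroup.IsReduced (a :: w))).card := by
  rw [extS, Finset.card_image_of_injective]
  · simp only [Finset.card_filter]
    rw [Finset.sum_product]
  · rintro ⟨a, b⟩ ⟨c, d⟩ h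
    simp at h
    simp [h]

theorem card_letters (b : Fin r × Bool) (w : List (Fin r × Bool))
    (h : FreeGroup.IsReduced (b :: w)) :
    (Finset.univ.filter
      (fun a : Fin r × Bool => FreeGroup.IsReduced (a :: b :: w))).card = 2 * r - 1 := by
  have : (Finset.univ.filter
      (fun a : Fin r × Bool => FreeGroup.IsReduced (a :: b :: w))) = Finset.univ.erase (linv b) := by
    ext ⟨a1, a2⟩
    obtain ⟨b1, b2⟩ := b
    simp only [FreeGroup.isReduced_cons_cons, h, linv]
    cases a2 <;> cases b2 <;> simp
  rw [this, Finset.card_erase_of_mem (Finset.mem_univ _)]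
  simp [mul_comm]

theorem card_letters_le (b : Fin r × Bool) (w : List (Fin r × Bool)) :
    (Finset.univ.filter
      (fun a : Fin r × Bool => FreeGroup.IsReduced (a :: b :: w))).card ≤ 2 * r - 1 := by
  by_cases h : FreeGroup.IsReduced (b :: w)
  · exact (card_letters b w h).le
  · rw [Finset.card_eq_zero.2]
    · omega
    · ext a
      simp [FreeGroup.isReduced_cons_cons, h]

theorem card_extS_le (S : Finset (List (Fin r × Bool))) (h : ∀ w ∈ S, w ≠ []) :
    (extS S).card ≤ (2 * r - 1) * S.card := by
  rw [card_extS, mul_comm]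
  apply Finset.sum_le_card_nsmul
  intro w hw
  obtain ⟨b, w, rfl⟩ := List.exists_cons_of_ne_nil (h w hw)
  exact card_letters_le b w

theorem extS_ne_nil (S : Finset (List (Fin r × Bool))) : ∀ w ∈ extS S, w ≠ [] := by
  intro w hw
  obtain ⟨a, v, rfl, -⟩ := mem_extS.1 hw
  simp

/-- Reduced words of length `n`. -/
noncomputable def redW (r : ℕ) : ℕ → Finset (List (Fin r × Bool))
  | 0 => {[]}
  | n + 1 => extS (redW r n)

theorem mem_redW {n : ℕ} {L : List (Fin r × Bool)} :
    L ∈ redW r n ↔ L.length = n ∧ FreeGroup.IsReduced L := by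
  induction n generalizing L with
  | zero => 
    simp only [redW, Finset.mem_singleton, List.length_eq_zero_iff]
    constructor
    · rintro rfl
      simp
    · exact fun h => h.1
  | succ n ih =>
    rw [redW, mem_extS]
    constructor
    · rintro ⟨a, w, rfl, hw, h⟩
      exact ⟨by simp [(ih.1 hw).1], h⟩
    · rintro ⟨h1, h2⟩
      obtain ⟨a, w, rfl⟩ := List.exists_cons_of_ne_nil (l := L) (by rintro rfl; simp at h1)
      refine ⟨a, w, rfl, ih.2 ⟨by simpa using h1, ?_⟩, h2⟩
      exact h2.infix ⟨[a], [], by simp⟩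

theorem card_redW_one : (redW r 1).card = 2 * r := by
  simp [redW, card_extS, mul_comm]

theorem card_redW_succ (n : ℕ) : (redW r (n + 2)).card = (2 * r - 1) * (redW r (n + 1)).card := by
  rw [redW, card_extS, mul_comm]
  apply Finset.sum_const_nat
  intro w hw
  obtain ⟨h1, h2⟩ := mem_redW.1 hw
  obtain ⟨a, w, rfl⟩ := List.exists_cons_of_ne_nil (l := w) (by rintro rfl; simp at h1)
  exact card_letters a w h2

theorem card_redW_le (hr : 2 ≤ r) (n : ℕ) : (redW r n).card ≤ 2 * (2 * r - 1) ^ n := by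
  rcases n with _ | n
  · simp [redW]
  induction n with
  | zero => simp [card_redW_one]; omega
  | succ n ih =>
    rw [card_redW_succ, pow_succ]
    nlinarith

theorem le_card_redW (hr : 2 ≤ r) (n : ℕ) : (2 * r - 1) ^ n ≤ (redW r n).card := by
  rcases n with _ | n
  · simp [redW]
  induction n with
  | zero => simp [card_redW_one]
  | succ n ih =>
    rw [card_redW_succ, pow_succ]
    nlinarith

open Classical in
/-- Reduced words of length `n` that do not contain `t`. -/
noncomputable def avoidW (t : List (Fin r × Bool)) (n : ℕ) : Finset (List (Fin r × Bool)) :=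
  (redW r n).filter (fun L => ¬ t <:+: L)

theorem exists_joint (hr : 2 ≤ r) (x y : Fin r × Bool) :
    ∃ s : Fin r × Bool, s ≠ linv x ∧ s ≠ linv y := by
  by_contra! h
  have : (Finset.univ : Finset (Fin r × Bool)) ⊆ {linv x, linv y} := by
    intro s _
    simp only [Finset.mem_insert, Finset.mem_singleton]
    by_cases hs : s = linv x
    · exact Or.inl hs
    · exact Or.inr (h s hs)
  have h2 := (Finset.card_le_card this).trans Finset.card_le_two
  simp at h2
  omega

theorem ne_linv_iff (a b : Fin r × Bool) : a ≠ linv b ↔ (a.1 = b.1 → a.2 = b.2) := by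
  obtain ⟨a1, a2⟩ := a
  obtain ⟨b1, b2⟩ := b
  cases a2 <;> cases b2 <;> simp [linv]

theorem exists_bridge (hr : 2 ≤ r) (t w : List (Fin r × Bool)) (ht : FreeGroup.IsReduced t)
    (htl : t.length = 3) (hw : FreeGroup.IsReduced w) (hw0 : w ≠ []) :
    ∃ s, FreeGroup.IsReduced (t ++ s :: w) := by
  obtain ⟨b, w, rfl⟩ := List.exists_cons_of_ne_nil hw0
  match t, htl with
  | [x, y, z], _ =>
    obtain ⟨s, h1, h2⟩ := exists_joint hr z b
    refine ⟨s, ?_⟩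
    rw [ne_linv_iff] at h1 h2
    simp only [FreeGroup.isReduced_cons_cons, List.cons_append, List.nil_append] at ht ⊢
    refine ⟨ht.1, ht.2.1, ?_, h2, hw⟩
    intro h
    exact (h1 h.symm).symm

theorem avoid_step (hr : 2 ≤ r) (t : List (Fin r × Bool)) (ht : FreeGroup.IsReduced t)
    (htl : t.length = 3) (m : ℕ) :
    (avoidW t (m + 1 + 4)).card ≤ ((2 * r - 1) ^ 4 - 1) * (avoidW t (m + 1)).card := by
  classical
  set S := avoidW t (m + 1) with hS
  have hSr : ∀ w ∈ S, w.length = m + 1 ∧ FreeGroup.IsReduced w := by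
    intro w hw
    exact mem_redW.1 (Finset.mem_filter.1 hw).1
  have hS0 : ∀ w ∈ S, w ≠ [] := by
    rintro w hw rfl
    simpa using (hSr _ hw).1
  have hc : (extS (extS (extS (extS S)))).card ≤ (2 * r - 1) ^ 4 * S.card := by
    have h1 := card_extS_le S hS0
    have h2 := card_extS_le _ (extS_ne_nil S)
    have h3 := card_extS_le _ (extS_ne_nil (extS S))
    have h4 := card_extS_le _ (extS_ne_nil (extS (extS S)))
    calc _ ≤ _ := h4
      _ ≤ (2 * r - 1) * ((2 * r - 1) * ((2 * r - 1) * ((2 * r - 1) * S.card))) := by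
        gcongr
        refine h3.trans ?_
        gcongr
        refine h2.trans ?_
        gcongr
      _ = _ := by ring
  have hex : ∀ w ∈ S, ∃ s, FreeGroup.IsReduced (t ++ s :: w) := fun w hw =>
    exists_bridge hr t w ht htl (hSr w hw).2 (hS0 w hw)
  have hx : Nonempty (Fin r × Bool) := ⟨⟨⟨0, by omega⟩, true⟩⟩
  choose! s hs using hex
  let B := S.image (fun w => t ++ s w :: w)
  have hB : B.card = S.card := by
    apply Finset.card_image_of_injOn
    intro w _ v _ h
    have := List.append_cancel_left h
    simp at this
    exact this.2
  have mem4 : ∀ (x y z u : Fin r × Bool) (w : List (Fin r × Bool)), w ∈ S →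
      FreeGroup.IsReduced (x :: y :: z :: u :: w) →
      (x :: y :: z :: u :: w) ∈ extS (extS (extS (extS S))) := by
    intro x y z u w hw h
    have h1 : FreeGroup.IsReduced (y :: z :: u :: w) := h.infix ⟨[x], [], by simp⟩
    have h2 : FreeGroup.IsReduced (z :: u :: w) := h.infix ⟨[x, y], [], by simp⟩
    have h3 : FreeGroup.IsReduced (u :: w) := h.infix ⟨[x, y, z], [], by simp⟩
    exact mem_extS.2 ⟨_, _, rfl, mem_extS.2 ⟨_, _, rfl, mem_extS.2 ⟨_, _, rfl,
      mem_extS.2 ⟨_, _, rfl, hw, h3⟩, h2⟩, h1⟩, h⟩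
  have hBsub : B ⊆ extS (extS (extS (extS S))) := by
    intro L hL
    obtain ⟨w, hw, rfl⟩ := Finset.mem_image.1 hL
    have h := hs w hw
    clear_value B S
    match t, htl with
    | [x, y, z], _ => exact mem4 x y z (s w) w hw h
  have hA : avoidW t (m + 1 + 4) ⊆ extS (extS (extS (extS S))) \ B := by
    intro L hL
    obtain ⟨hL1, hL2⟩ := Finset.mem_filter.1 hL
    obtain ⟨hl, hred⟩ := mem_redW.1 hL1
    rw [Finset.mem_sdiff]
    constructor
    · match L, hl with
      | x :: y :: z :: u :: w, hl =>
        refine mem4 x y z u w ?_ hred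
        refine Finset.mem_filter.2 ⟨mem_redW.2 ⟨by simpa using hl, 
          hred.infix ⟨[x, y, z, u], [], by simp⟩⟩, ?_⟩
        intro h
        exact hL2 (h.trans ⟨[x, y, z, u], [], by simp⟩)
    · intro hLB
      obtain ⟨w, hw, rfl⟩ := Finset.mem_image.1 hLB
      exact hL2 ⟨[], s w :: w, by simp⟩
  have h := Finset.card_le_card hA
  rw [Finset.card_sdiff_of_subset hBsub, hB] at h
  rw [Nat.sub_mul, one_mul]
  omega

theorem avoid_le (hr : 2 ≤ r) (t : List (Fin r × Bool)) (ht : FreeGroup.IsReduced t)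
    (htl : t.length = 3) (lam : ℝ) (h1 : 1 ≤ lam) (h4 : lam ^ 4 = (2 * r - 1 : ℝ) ^ 4 - 1) (m : ℕ) :
    ((avoidW t m).card : ℝ) ≤ 2 * (2 * r - 1 : ℝ) ^ 4 * lam ^ m := by
  have hr' : (2 : ℝ) ≤ r := by exact_mod_cast hr
  have hq : ((2 * r - 1 : ℕ) : ℝ) = 2 * r - 1 := by
    rw [Nat.cast_sub (by omega)]
    push_cast
    ring
  induction m using Nat.strong_induction_on with
  | _ m ih =>
    by_cases hm : m ≤ 4
    · have ha : (avoidW t m).card ≤ 2 * (2 * r - 1) ^ m :=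
        (Finset.card_filter_le _ _).trans (card_redW_le hr m)
      have hb : ((avoidW t m).card : ℝ) ≤ 2 * (2 * r - 1 : ℝ) ^ m := by
        rw [← hq]
        exact_mod_cast ha
      have hc : (2 * r - 1 : ℝ) ^ m ≤ (2 * r - 1 : ℝ) ^ 4 := pow_le_pow_right₀ (by linarith) hm
      have hd : 1 ≤ lam ^ m := one_le_pow₀ h1
      have he : 0 ≤ (2 * r - 1 : ℝ) ^ 4 := by positivity
      nlinarith
    · obtain ⟨k, rfl⟩ : ∃ k, m = k + 1 + 4 := ⟨m - 5, by omega⟩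
      have ha := avoid_step hr t ht htl k
      have hb : ((avoidW t (k + 1 + 4)).card : ℝ) ≤ lam ^ 4 * (avoidW t (k + 1)).card := by
        rw [h4, ← hq]
        have : (((2 * r - 1 : ℕ) : ℝ) ^ 4 - 1) = (((2 * r - 1) ^ 4 - 1 : ℕ) : ℝ) := by
          rw [Nat.cast_sub (Nat.one_le_pow _ _ (by omega))]
          push_cast
          ring
        rw [this]
        exact_mod_cast ha
      have hc := ih (k + 1) (by omega)
      calc _ ≤ _ := hb
        _ ≤ lam ^ 4 * (2 * (2 * r - 1 : ℝ) ^ 4 * lam ^ (k + 1)) := by gcongr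
        _ = _ := by ring

theorem not_full_dest (w : FreeGroup (Fin r)) (h : ¬ Full w) :
    ∃ t : List (Fin r × Bool), t ∈ redW r 3 ∧ ∃ u c : List (Fin r × Bool),
      FreeGroup.IsReduced u ∧ c ∈ avoidW t c.length ∧
      w.toWord = u ++ c ++ FreeGroup.invRev u := by
  simp only [Full, not_forall, not_or] at h
  obtain ⟨t, ht, hn, -⟩ := h
  have hw : FreeGroup.IsReduced w.toWord := FreeGroup.isReduced_toWord
  have heq := FreeGroup.reduceCyclically.conj_conjugator_reduceCyclically w.toWord
  set u := FreeGroup.reduceCyclically.conjugator w.toWord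
  have hc := FreeGroup.reduceCyclically.isCyclicallyReduced hw
  set c := FreeGroup.reduceCyclically w.toWord
  have hcw : (FreeGroup.mk c).toWord = c := by
    rw [FreeGroup.toWord_mk, hc.isReduced.reduce_eq]
  refine ⟨t.toWord, mem_redW.2 ⟨ht, FreeGroup.isReduced_toWord⟩, u, c, ?_, ?_, heq.symm⟩
  · exact hw.infix ⟨[], c ++ FreeGroup.invRev u, by simpa using heq⟩
  · refine Finset.mem_filter.2 ⟨mem_redW.2 ⟨rfl, hc.isReduced⟩, fun hin => hn ?_⟩
    refine ⟨FreeGroup.mk c, ⟨?_, FreeGroup.mk u, ?_⟩, 1, le_rfl, ?_⟩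
    · intro a ha b hb hab
      rw [hcw] at ha hb
      have := hc.2 b hb a ha
      rw [hab] at this
      simp at this
    · rw [FreeGroup.inv_mk, FreeGroup.mul_mk, FreeGroup.mul_mk, heq, FreeGroup.mk_toWord]
    · rw [Subword, pow_one, hcw]
      exact hin

open Classical in
/-- A finite set of words containing the words of all non-full elements of length at most `n`. -/
noncomputable def badW (r n : ℕ) : Finset (List (Fin r × Bool)) :=
  (redW r 3).biUnion fun t =>
    (((Finset.range (n + 1)) ×ˢ (Finset.range (n + 1))).filter (fun p => 2 * p.1 + p.2 ≤ n)).biUnion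
      fun p => ((redW r p.1) ×ˢ (avoidW t p.2)).image (fun x => x.1 ++ x.2 ++ FreeGroup.invRev x.1)

theorem mem_badW (w : FreeGroup (Fin r)) (n : ℕ) (h : ¬ Full w) (hl : len w ≤ n) :
    w.toWord ∈ badW r n := by
  obtain ⟨t, ht, u, c, hu, hc, he⟩ := not_full_dest w h
  have hlen : w.toWord.length = u.length + c.length + u.length := by
    rw [he]; simp [FreeGroup.invRev_length, add_assoc]
  rw [len] at hl
  simp only [badW, Finset.mem_biUnion]
  refine ⟨t, ht, (u.length, c.length), ?_, ?_⟩
  · simp only [Finset.mem_filter, Finset.mem_product, Finset.mem_range]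
    omega
  · refine Finset.mem_image.2 ⟨(u, c), ?_, he.symm⟩
    exact Finset.mem_product.2 ⟨mem_redW.2 ⟨rfl, hu⟩, hc⟩

theorem card_badW_le (hr : 2 ≤ r) (lam : ℝ) (h1 : 1 ≤ lam)
    (h4 : lam ^ 4 = (2 * r - 1 : ℝ) ^ 4 - 1) (h2 : (2 * r - 1 : ℝ) ≤ lam ^ 2) (n : ℕ) :
    ((badW r n).card : ℝ) ≤
      (redW r 3).card * ((n + 1) ^ 2 * (4 * (2 * r - 1 : ℝ) ^ 4 * lam ^ n)) := by
  classical
  have hr' : (2 : ℝ) ≤ r := by exact_mod_cast hr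
  have hq : ((2 * r - 1 : ℕ) : ℝ) = 2 * r - 1 := by
    rw [Nat.cast_sub (by omega)]
    push_cast
    ring
  have key : ∀ t ∈ redW r 3, ∀ p : ℕ × ℕ, 2 * p.1 + p.2 ≤ n →
      ((((redW r p.1) ×ˢ (avoidW t p.2)).image
        (fun x => x.1 ++ x.2 ++ FreeGroup.invRev x.1)).card : ℝ) ≤
        4 * (2 * r - 1 : ℝ) ^ 4 * lam ^ n := by
    intro t ht p hp
    obtain ⟨htl, htr⟩ := mem_redW.1 ht
    have ha : ((((redW r p.1) ×ˢ (avoidW t p.2)).image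
        (fun x => x.1 ++ x.2 ++ FreeGroup.invRev x.1)).card : ℝ) ≤
        (redW r p.1).card * (avoidW t p.2).card := by
      have := Finset.card_image_le (s := (redW r p.1) ×ˢ (avoidW t p.2))
        (f := fun x => x.1 ++ x.2 ++ FreeGroup.invRev x.1)
      rw [Finset.card_product] at this
      exact_mod_cast this
    have hb : ((redW r p.1).card : ℝ) ≤ 2 * (lam ^ 2) ^ p.1 := by
      have : ((redW r p.1).card : ℝ) ≤ 2 * (2 * r - 1 : ℝ) ^ p.1 := by
        rw [← hq]
        exact_mod_cast card_redW_le hr p.1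
      refine this.trans ?_
      have : (0 : ℝ) ≤ 2 * r - 1 := by linarith
      gcongr
    have hc := avoid_le hr t htr htl lam h1 h4 p.2
    calc _ ≤ _ := ha
      _ ≤ (2 * (lam ^ 2) ^ p.1) * (2 * (2 * r - 1 : ℝ) ^ 4 * lam ^ p.2) := by gcongr
      _ = 4 * (2 * r - 1 : ℝ) ^ 4 * lam ^ (2 * p.1 + p.2) := by ring
      _ ≤ _ := by gcongr
  have hK : 0 ≤ 4 * (2 * r - 1 : ℝ) ^ 4 * lam ^ n := by positivity
  unfold badW
  refine card_biUnion_le_real _ _ _ ?_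
  intro t ht
  refine (card_biUnion_le_real _ _ (4 * (2 * r - 1 : ℝ) ^ 4 * lam ^ n) ?_).trans ?_
  · intro p hp
    convert key t ht p (Finset.mem_filter.1 hp).2
  · gcongr
    have := Finset.card_filter_le ((Finset.range (n + 1)) ×ˢ (Finset.range (n + 1)))
      (fun p => 2 * p.1 + p.2 ≤ n)
    rw [Finset.card_product, Finset.card_range, ← sq] at this
    exact_mod_cast this

theorem finite_ball (n : ℕ) : {w : FreeGroup (Fin r) | len w ≤ n}.Finite := by
  apply Set.Finite.of_injOn (f := FreeGroup.toWord) (t := {l | l.length ≤ n})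
  · intro w hw
    exact hw
  · exact FreeGroup.toWord_injective.injOn
  · exact List.finite_length_le _ n

theorem ball_univ_ge (hr : 2 ≤ r) (n : ℕ) :
    (2 * r - 1) ^ n ≤ ballCount (Set.univ : Set (FreeGroup (Fin r))) n := by
  refine (le_card_redW hr n).trans ?_
  rw [ballCount, ← Set.ncard_coe_finset]
  refine Set.ncard_le_ncard_of_injOn FreeGroup.mk ?_ ?_ ?_
  · intro L hL
    obtain ⟨h1, h2⟩ := mem_redW.1 hL
    simp [len, FreeGroup.toWord_mk, h2.reduce_eq, h1]
  · intro L hL M hM h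
    obtain ⟨-, h2⟩ := mem_redW.1 hL
    obtain ⟨-, h3⟩ := mem_redW.1 hM
    have := congrArg FreeGroup.toWord h
    rwa [FreeGroup.toWord_mk, FreeGroup.toWord_mk, h2.reduce_eq, h3.reduce_eq] at this
  · simpa using finite_ball n

theorem ball_univ_le (n : ℕ) :
    ballCount (Set.univ : Set (FreeGroup (Fin r))) n ≤
      ballCount {w : FreeGroup (Fin r) | Full w} n + (badW r n).card := by
  have hsub : {w : FreeGroup (Fin r) | w ∈ (Set.univ : Set (FreeGroup (Fin r))) ∧ len w ≤ n} ⊆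
      {w | w ∈ {w : FreeGroup (Fin r) | Full w} ∧ len w ≤ n} ∪
        {w | ¬ Full w ∧ len w ≤ n} := by
    rintro w ⟨-, hw⟩
    by_cases h : Full w
    · exact Or.inl ⟨h, hw⟩
    · exact Or.inr ⟨h, hw⟩
  have hf1 : {w | w ∈ {w : FreeGroup (Fin r) | Full w} ∧ len w ≤ n}.Finite :=
    (finite_ball n).subset fun w hw => hw.2
  have hf2 : {w : FreeGroup (Fin r) | ¬ Full w ∧ len w ≤ n}.Finite :=
    (finite_ball n).subset fun w hw => hw.2
  refine (Set.ncard_le_ncard hsub (hf1.union hf2)).trans ((Set.ncard_union_le _ _).trans ?_)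
  refine Nat.add_le_add_left ?_ _
  rw [← Set.ncard_coe_finset]
  refine Set.ncard_le_ncard_of_injOn FreeGroup.toWord ?_ FreeGroup.toWord_injective.injOn
    (Finset.finite_toSet _)
  intro w hw
  exact mem_badW w n hw.1 hw.2

/-- the set of full elements is exponentially generic in `F`. -/
theorem full_expGeneric {r : ℕ} (hr : 2 ≤ r) :
    ExpGeneric {w : FreeGroup (Fin r) | Full w}
      (Set.univ : Set (FreeGroup (Fin r))) := by
  have hr' : (2 : ℝ) ≤ r := by exact_mod_cast hr
  have hq : ((2 * r - 1 : ℕ) : ℝ) = 2 * r - 1 := by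
    rw [Nat.cast_sub (by omega)]
    push_cast
    ring
  obtain ⟨q, hqd⟩ : ∃ q : ℝ, q = 2 * r - 1 := ⟨_, rfl⟩
  have hq3 : 3 ≤ q := by linarith
  have hq2 : 9 ≤ q ^ 2 := by nlinarith
  have hq4 : q ^ 2 ≤ q ^ 4 - 1 := by nlinarith
  obtain ⟨lam, hlam0, h4⟩ : ∃ lam : ℝ, 0 ≤ lam ∧ lam ^ 4 = q ^ 4 - 1 := by
    refine ⟨√√(q ^ 4 - 1), by positivity, ?_⟩
    have hnn : 0 ≤ q ^ 4 - 1 := by nlinarith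
    calc (√√(q ^ 4 - 1)) ^ 4 = ((√√(q ^ 4 - 1)) ^ 2) ^ 2 := by ring
      _ = q ^ 4 - 1 := by rw [Real.sq_sqrt (by positivity), Real.sq_sqrt hnn]
  have h2 : q ≤ lam ^ 2 := by
    apply le_of_sq_le_sq _ (by positivity)
    nlinarith
  have h1 : 1 ≤ lam := by nlinarith
  have hlt : lam < q := by
    apply lt_of_pow_lt_pow_left₀ 4 (by linarith)
    linarith
  have hqpos : 0 < q := by linarith
  obtain ⟨σ, hσd⟩ : ∃ σ : ℝ, σ = √(lam / q) := ⟨_, rfl⟩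
  have hρ : 0 < lam / q := by positivity
  have hσ0 : 0 < σ := hσd ▸ Real.sqrt_pos.2 hρ
  have hσ1 : σ < 1 := by
    rw [hσd, Real.sqrt_lt' one_pos, one_pow, div_lt_one hqpos]
    exact hlt
  have hσsq : σ ^ 2 = lam / q := by rw [hσd, Real.sq_sqrt hρ.le]
  have htend := tendsto_pow_const_mul_const_pow_of_abs_lt_one 2 (r := σ)
    (by rw [abs_of_pos hσ0]; exact hσ1)
  have hev := htend.eventually (gt_mem_nhds (one_pos))
  obtain ⟨N, hN⟩ := Filter.eventually_atTop.1 hev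
  obtain ⟨K, hKd⟩ : ∃ K : ℝ, K = (redW r 3).card * (16 * q ^ 4) := ⟨_, rfl⟩
  have hcard : 0 < ((redW r 3).card : ℝ) := by
    have := le_card_redW hr 3
    have h3 : 0 < (2 * r - 1) ^ 3 := Nat.pow_pos (by omega)
    exact_mod_cast h3.trans_le this
  have hK : 0 < K := by rw [hKd]; positivity
  refine ⟨-Real.log σ, by have := Real.log_neg hσ0 hσ1; linarith, Real.log K, max N 1, ?_⟩
  intro n hn
  have hn1 : (1 : ℝ) ≤ n := by exact_mod_cast (le_max_right _ _).trans hn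
  have hNn := hN n ((le_max_left _ _).trans hn)
  have hexp : Real.exp (Real.log K - -Real.log σ * n) = K * σ ^ n := by
    rw [show Real.log K - -Real.log σ * n = Real.log K + n * Real.log σ by ring, Real.exp_add,
      Real.exp_log hK, Real.exp_nat_mul, Real.exp_log hσ0]
  rw [hexp]
  have hbad := card_badW_le hr lam h1 (hqd ▸ h4) (hqd ▸ h2) n
  rw [← hqd] at hbad
  have hge : q ^ n ≤ (ballCount (Set.univ : Set (FreeGroup (Fin r))) n : ℝ) := by
    rw [hqd, ← hq]
    exact_mod_cast ball_univ_ge hr n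
  have hle : (ballCount (Set.univ : Set (FreeGroup (Fin r))) n : ℝ) ≤
      ballCount {w : FreeGroup (Fin r) | Full w} n + (badW r n).card := by
    exact_mod_cast ball_univ_le n
  have hqn : 0 < q ^ n := by positivity
  have hlamn : lam ^ n = σ ^ n * σ ^ n * q ^ n := by
    rw [← mul_pow, ← mul_pow, ← sq, hσsq]
    congr 1
    field_simp
  have hbad2 : ((badW r n).card : ℝ) ≤ K * σ ^ n * q ^ n := by
    refine hbad.trans ?_
    have hsq : ((n : ℝ) + 1) ^ 2 ≤ 4 * (n : ℝ) ^ 2 := by nlinarith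
    calc _ ≤ ((redW r 3).card : ℝ) * ((4 * (n : ℝ) ^ 2) * (4 * q ^ 4 * lam ^ n)) := by gcongr
      _ = K * σ ^ n * q ^ n * ((n : ℝ) ^ 2 * σ ^ n) := by rw [hlamn, hKd]; ring
      _ ≤ K * σ ^ n * q ^ n * 1 := by gcongr
      _ = _ := mul_one _
  rw [le_div_iff₀ (hqn.trans_le hge)]
  have : K * σ ^ n * q ^ n ≤
      K * σ ^ n * (ballCount (Set.univ : Set (FreeGroup (Fin r))) n : ℝ) := by gcongr
  linarith

end VG
end

section
/- Let r ≥ 2, let F be the free group of rank r, and let C ⊆ F be the set of cyclically reduced elements. The set of cyclically reduced elements of F that are not proper powers and are Whitehead minimal is exponentially generic in C; moreover, the set of elements of F that are not proper powers and whose cyclic reduction is Whitehead minimal is exponentially generic in F. -/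
namespace VG

variable {r : ℕ}

section part1
open FreeGroup

section basics
variable {r : ℕ}

/-- Free group elements whose reduced word starts with the letter `a`. -/
def HC (a : Fin r × Bool) : Set (FreeGroup (Fin r)) := {g | (toWord g).head? = some a}

lemma linv_linv (a : Fin r × Bool) : linv (linv a) = a := by simp [linv]

lemma linv_ne (a : Fin r × Bool) : linv a ≠ a := by
  rcases a with ⟨i, b⟩; cases b <;> simp [linv]

lemma rel_iff (a b : Fin r × Bool) : (a.1 = b.1 → a.2 = b.2) ↔ b ≠ linv a := by
  rcases a with ⟨i, x⟩; rcases b with ⟨j, y⟩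
  simp only [linv, ne_eq, Prod.mk.injEq, not_and]
  constructor
  · rintro h rfl; have := h rfl; subst this; cases x <;> simp
  · rintro h rfl; have := h rfl; cases x <;> cases y <;> simp_all

lemma toWord_mk_red {l : List (Fin r × Bool)} (h : IsReduced l) : (mk l).toWord = l := by
  rw [toWord_mk, h.reduce_eq]

lemma toWord_mul_red {g h : FreeGroup (Fin r)} (H : IsReduced (g.toWord ++ h.toWord)) :
    (g * h).toWord = g.toWord ++ h.toWord := by
  rw [toWord_mul, H.reduce_eq]

lemma mk_linv (a : Fin r × Bool) : (mk [linv a] : FreeGroup (Fin r)) = (mk [a])⁻¹ := by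
  simp [inv_mk, linv, invRev]

lemma isReduced_cons_iff (a : Fin r × Bool) (l : List (Fin r × Bool)) :
    IsReduced (a :: l) ↔ (l.head? ≠ some (linv a)) ∧ IsReduced l := by
  rw [FreeGroup.IsReduced, List.isChain_cons]
  refine and_congr ?_ Iff.rfl
  cases l with
  | nil => simp
  | cons b t =>
    simp only [List.head?_cons, Option.mem_def, Option.some.injEq, forall_eq', ne_eq]
    exact rel_iff a b

lemma toWord_letter_mul (a : Fin r × Bool) (g : FreeGroup (Fin r)) :
    (g ∉ HC (linv a) ∧ (mk [a] * g).toWord = a :: g.toWord) ∨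
    (g ∈ HC (linv a) ∧ g.toWord = linv a :: (mk [a] * g).toWord) := by
  by_cases h : g ∈ HC (linv a)
  · right
    refine ⟨h, ?_⟩
    have hr : IsReduced g.toWord := isReduced_toWord
    rcases hw : g.toWord with _ | ⟨b, t⟩
    · simp [HC, hw] at h
    · have hb : b = linv a := by simpa [HC, hw] using h
      subst hb
      have ht : IsReduced t := by rw [hw] at hr; exact ((isReduced_cons_iff _ _).1 hr).2
      have : mk [a] * g = mk t := by
        conv_lhs => rw [← mk_toWord (x := g), hw]
        rw [show (linv a :: t) = [linv a] ++ t from rfl, ← mul_mk, mk_linv]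
        group
      rw [this, toWord_mk_red ht]
  · left
    refine ⟨h, ?_⟩
    have : IsReduced (a :: g.toWord) := (isReduced_cons_iff _ _).2 ⟨h, isReduced_toWord⟩
    have e : mk [a] * g = mk (a :: g.toWord) := by
      conv_lhs => rw [← mk_toWord (x := g)]
      rw [mul_mk]; rfl
    rw [e, toWord_mk_red this]

lemma letter_mul_mem_HC (a : Fin r × Bool) (g : FreeGroup (Fin r)) :
    mk [a] * g ∈ HC a ↔ g ∉ HC (linv a) := by
  rcases toWord_letter_mul a g with ⟨h1, h2⟩ | ⟨h1, h2⟩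
  · simp [HC, h2] at h1 ⊢; exact h1
  · simp only [h1, not_true_eq_false, iff_false]
    intro h
    have hr : IsReduced g.toWord := isReduced_toWord
    rw [h2, isReduced_cons_iff, linv_linv] at hr
    exact hr.1 h

/-- right multiplication by a letter crosses the wall of `s` only at one place -/
lemma HC_mul_letter (s x : Fin r × Bool) (h : FreeGroup (Fin r))
    (H : ¬ (h ∈ HC s ↔ h * mk [x] ∈ HC s)) :
    (h = 1 ∧ x = s) ∨ (h = mk [s] ∧ x = linv s) := by
  have key : h⁻¹ ∉ HC x → h.toWord ≠ [] → (h ∈ HC s ↔ h * mk [x] ∈ HC s) := by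
    intro h1 h2
    have : (h * mk [x]).toWord = h.toWord ++ [x] := by
      rcases toWord_letter_mul (linv x) h⁻¹ with ⟨-, h4⟩ | ⟨h3, -⟩
      · have := congrArg invRev h4
        rw [← toWord_inv, mk_linv, mul_inv_rev, inv_inv, inv_inv] at this
        rw [this, toWord_inv]
        have := invRev_invRev (L₁ := h.toWord)
        simp only [invRev, List.map_cons, List.reverse_cons] at this ⊢
        rw [this]; simp [linv]
      · rw [linv_linv] at h3; exact absurd h3 h1
    simp only [HC, Set.mem_ofPred_eq, this, List.head?_append]
    rcases hw : h.toWord with _ | ⟨b, t⟩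
    · exact absurd hw h2
    · simp
  by_cases h2 : h.toWord = []
  · left
    have h1 : h = 1 := toWord_eq_nil_iff.1 h2
    refine ⟨h1, ?_⟩
    subst h1
    by_contra hne
    apply H
    have : (mk [x]).toWord = [x] := toWord_mk_red IsReduced.singleton
    simp [HC, this, hne]
  · by_cases h1 : h⁻¹ ∈ HC x
    · right
      set k := h * mk [x] with hk
      -- h = k * x⁻¹, k.toWord ++ [linv x]
      have hw : h.toWord = k.toWord ++ [linv x] := by
        rcases toWord_letter_mul (linv x) h⁻¹ with ⟨h3, -⟩ | ⟨-, h4⟩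
        · rw [linv_linv] at h3; exact absurd h1 h3
        · have := congrArg invRev h4
          rw [linv_linv, toWord_inv, invRev_invRev] at this
          rw [this]
          have e : mk [linv x] * h⁻¹ = k⁻¹ := by rw [mk_linv, hk, mul_inv_rev]
          rw [e, toWord_inv]
          have := invRev_invRev (L₁ := k.toWord)
          simp only [invRev, List.map_cons, List.reverse_cons] at this ⊢
          rw [this]; simp [linv]
      have hk0 : k.toWord = [] := by
        by_contra hne
        apply H
        simp only [HC, Set.mem_ofPred_eq, hw, List.head?_append]
        rcases hkk : k.toWord with _ | ⟨b, t⟩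
        · exact absurd hkk hne
        · simp
      have hx : linv x = s := by
        by_contra hne
        apply H
        simp [HC, hw, hk0, hne]
      refine ⟨?_, by rw [← hx, linv_linv]⟩
      rw [hk0, hx] at hw
      rw [← mk_toWord (x := h), hw]; rfl
    · exact absurd (key h1 h2) H

/-- The set of `g` such that `A` separates `g` from `g * v`. -/
def DS (A : Set (FreeGroup (Fin r))) (v : FreeGroup (Fin r)) : Set (FreeGroup (Fin r)) :=
  {g | ¬ (g ∈ A ↔ g * v ∈ A)}

/-- finite coboundary -/
def FC (A : Set (FreeGroup (Fin r))) : Prop := ∀ x : Fin r × Bool, (DS A (mk [x])).Finite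

lemma DS_mul_subset (A : Set (FreeGroup (Fin r))) (u v : FreeGroup (Fin r)) :
    DS A (u * v) ⊆ DS A u ∪ (fun g => g * u⁻¹) '' DS A v := by
  intro g hg
  by_cases h : g ∈ DS A u
  · exact Or.inl h
  · right
    refine ⟨g * u, ?_, by simp⟩
    simp only [DS, Set.mem_ofPred_eq, not_not, mul_assoc] at *
    rwa [← h]

lemma DS_one (A : Set (FreeGroup (Fin r))) : DS A 1 = ∅ := by
  ext g; simp [DS]

lemma DS_letters (A : Set (FreeGroup (Fin r))) (f : Fin r × Bool → ℕ)
    (hf : ∀ x, (DS A (mk [x])).Finite ∧ (DS A (mk [x])).ncard ≤ f x) (l : List (Fin r × Bool)) :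
    (DS A (mk l)).Finite ∧ (DS A (mk l)).ncard ≤ (l.map f).sum := by
  induction l with
  | nil => rw [← one_eq_mk, DS_one]; simp
  | cons x l ih =>
    have e : (mk (x :: l) : FreeGroup (Fin r)) = mk [x] * mk l := by rw [mul_mk]; rfl
    have hs := DS_mul_subset A (mk [x]) (mk l)
    rw [← e] at hs
    have hfin := (hf x).1.union (ih.1.image (fun g => g * (mk [x])⁻¹))
    refine ⟨hfin.subset hs, ?_⟩
    calc _ ≤ _ := Set.ncard_le_ncard hs hfin
      _ ≤ _ := Set.ncard_union_le _ _
      _ ≤ f x + (l.map f).sum := by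
          gcongr
          · exact (hf x).2
          · exact (Set.ncard_image_le ih.1).trans ih.2
      _ = _ := by simp

lemma FC.finite {A : Set (FreeGroup (Fin r))} (h : FC A) (v : FreeGroup (Fin r)) :
    (DS A v).Finite := by
  have := (DS_letters A (fun x => (DS A (mk [x])).ncard) (fun x => ⟨h x, le_rfl⟩) v.toWord).1
  rwa [mk_toWord] at this

lemma DS_HC_letter (s x : Fin r × Bool) : (DS (HC s) (mk [x])).Finite ∧
    (DS (HC s) (mk [x])).ncard ≤ if x = s ∨ x = linv s then 1 else 0 := by
  have h : DS (HC s) (mk [x]) ⊆ if x = s ∨ x = linv s then {if x = s then 1 else mk [s]} else ∅ := by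
    intro g hg
    rcases HC_mul_letter s x g hg with ⟨rfl, rfl⟩ | ⟨rfl, rfl⟩
    · simp
    · simp [linv_ne]
  split_ifs at h ⊢ with h1
  all_goals first
    | exact ⟨(Set.finite_singleton _).subset h, (Set.ncard_le_ncard h).trans (by simp)⟩
    | exact ⟨Set.finite_empty.subset h, (Set.ncard_le_ncard h).trans (by simp)⟩

lemma FC_HC (s : Fin r × Bool) : FC (HC s) := fun x => (DS_HC_letter s x).1

/-- number of occurrences of the generator `i` (either sign) in a list -/
def occ (i : Fin r) (l : List (Fin r × Bool)) : ℕ := (l.map (fun x => if x.1 = i then 1 else 0)).sum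

lemma DS_HC_list (i : Fin r) (l : List (Fin r × Bool)) :
    (DS (HC (i, true)) (mk l)).ncard ≤ occ i l := by
  refine (DS_letters _ (fun x => if x.1 = i then 1 else 0) (fun x => ?_) l).2
  have := DS_HC_letter (i, true) x
  refine ⟨this.1, this.2.trans ?_⟩
  rcases x with ⟨j, b⟩
  cases b <;> simp [linv]

lemma sum_occ (l : List (Fin r × Bool)) : ∑ i, occ i l = l.length := by
  induction l with
  | nil => simp [occ]
  | cons x l ih =>
    simp only [occ, List.map_cons, List.sum_cons, Finset.sum_add_distrib] at ih ⊢
    rw [ih]; simp [add_comm]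

lemma occ_flatten (i : Fin r) (Q : ℕ) (l : List (Fin r × Bool)) :
    occ i (List.replicate Q l).flatten = Q * occ i l := by
  induction Q with
  | zero => simp [occ]
  | succ n ih =>
    rw [List.replicate_succ, List.flatten_cons]
    unfold occ at *
    rw [List.map_append, List.sum_append, ih]; ring

lemma mk_flatten (Q : ℕ) (l : List (Fin r × Bool)) :
    (mk (List.replicate Q l).flatten : FreeGroup (Fin r)) = (mk l) ^ Q := by
  rw [pow_mk]

lemma D_HC_pow (i : Fin r) (v : FreeGroup (Fin r)) (Q : ℕ) :
    (DS (HC (i, true)) (v ^ Q)).ncard ≤ Q * occ i v.toWord := by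
  have := DS_HC_list i (List.replicate Q v.toWord).flatten
  rwa [mk_flatten, mk_toWord, occ_flatten] at this

/-- Two sets have equal crossing numbers up to bounded error. -/
def Equi (A B : Set (FreeGroup (Fin r))) : Prop :=
  ∀ w : FreeGroup (Fin r), ∃ c : ℕ, ∀ Q : ℕ, (DS A (w ^ Q)).ncard ≤ (DS B (w ^ Q)).ncard + c ∧
    (DS B (w ^ Q)).ncard ≤ (DS A (w ^ Q)).ncard + c

lemma Equi.symm {A B : Set (FreeGroup (Fin r))} (h : Equi A B) : Equi B A := fun w => by
  obtain ⟨c, hc⟩ := h w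
  exact ⟨c, fun Q => (hc Q).symm⟩

lemma Equi.trans {A B C : Set (FreeGroup (Fin r))} (h : Equi A B) (h' : Equi B C) : Equi A C :=
  fun w => by
  obtain ⟨c, hc⟩ := h w
  obtain ⟨d, hd⟩ := h' w
  refine ⟨c + d, fun Q => ?_⟩
  have := hc Q
  have := hd Q
  omega

lemma Equi.of_card {A B : Set (FreeGroup (Fin r))}
    (h : ∀ v, (DS A v).ncard = (DS B v).ncard) : Equi A B :=
  fun w => ⟨0, fun Q => by simp [h]⟩

lemma DS_compl (A : Set (FreeGroup (Fin r))) (v : FreeGroup (Fin r)) : DS Aᶜ v = DS A v := by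
  ext g; simp only [DS, Set.mem_ofPred_eq, Set.mem_compl_iff]; tauto

lemma Equi.compl (A : Set (FreeGroup (Fin r))) : Equi Aᶜ A := Equi.of_card fun v => by rw [DS_compl]

/-- translate -/
def tr (u : FreeGroup (Fin r)) (A : Set (FreeGroup (Fin r))) : Set (FreeGroup (Fin r)) :=
  {g | u⁻¹ * g ∈ A}

lemma DS_tr (u : FreeGroup (Fin r)) (A : Set (FreeGroup (Fin r))) (v : FreeGroup (Fin r)) :
    DS (tr u A) v = (fun g => u * g) '' DS A v := by
  ext g
  constructor
  · intro h
    refine ⟨u⁻¹ * g, ?_, by simp⟩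
    simpa [DS, tr, mul_assoc] using h
  · rintro ⟨g, h, rfl⟩
    simpa [DS, tr, mul_assoc] using h

lemma Equi.tr (u : FreeGroup (Fin r)) (A : Set (FreeGroup (Fin r))) : Equi (tr u A) A :=
  Equi.of_card fun v => by
    rw [DS_tr, Set.ncard_image_of_injective _ (mul_right_injective u)]

lemma FC.tr {A : Set (FreeGroup (Fin r))} (h : FC A) (u : FreeGroup (Fin r)) : FC (tr u A) :=
  fun x => by rw [DS_tr]; exact (h x).image _

lemma DS_subset_of_fin (A B : Set (FreeGroup (Fin r))) (v : FreeGroup (Fin r)) :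
    DS A v ⊆ DS B v ∪ (symmDiff A B ∪ (fun g => g * v⁻¹) '' symmDiff A B) := by
  intro g hg
  by_cases h1 : g ∈ symmDiff A B
  · exact Or.inr (Or.inl h1)
  by_cases h2 : g * v ∈ symmDiff A B
  · exact Or.inr (Or.inr ⟨_, h2, by simp⟩)
  left
  simp only [DS, Set.mem_symmDiff, Set.mem_ofPred_eq] at *
  tauto

lemma ncard_DS_le {A B : Set (FreeGroup (Fin r))} (hB : FC B) (h : (symmDiff A B).Finite)
    (v : FreeGroup (Fin r)) :
    (DS A v).Finite ∧ (DS A v).ncard ≤ (DS B v).ncard + 2 * (symmDiff A B).ncard := by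
  have hf := ((hB.finite v).union (h.union (h.image (fun g => g * v⁻¹))))
  refine ⟨hf.subset (DS_subset_of_fin A B v), ?_⟩
  refine (Set.ncard_le_ncard (DS_subset_of_fin A B v) hf).trans ?_
  refine (Set.ncard_union_le _ _).trans ?_
  have := Set.ncard_union_le (symmDiff A B) ((fun g => g * v⁻¹) '' symmDiff A B)
  have := Set.ncard_image_le (f := fun g => g * v⁻¹) h
  omega

lemma Equi.of_fin {A B : Set (FreeGroup (Fin r))} (hB : FC B) (h : (symmDiff A B).Finite) :
    Equi A B := by
  have hA : FC A := fun x => (ncard_DS_le hB h _).1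
  refine fun w => ⟨2 * (symmDiff A B).ncard, fun Q => ⟨(ncard_DS_le hB h _).2, ?_⟩⟩
  have h' := h
  rw [symmDiff_comm] at h'
  have := (ncard_DS_le hA h' (w ^ Q)).2
  rwa [symmDiff_comm B A] at this

lemma Equi.HC_linv (a : Fin r × Bool) : Equi (HC (linv a)) (HC a) := by
  have : HC (linv a) = (VG.tr (mk [a])⁻¹ (HC a))ᶜ := by
    ext g
    have := letter_mul_mem_HC a g
    simp only [VG.tr, Set.mem_compl_iff, Set.mem_ofPred_eq, inv_inv]
    tauto
  rw [this]
  exact (Equi.compl _).trans (Equi.tr _ _)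

lemma Equi.HC_true (a : Fin r × Bool) : Equi (HC a) (HC (a.1, true)) := by
  rcases a with ⟨i, b⟩
  cases b
  · exact Equi.HC_linv (i, true)
  · exact Equi.of_card fun v => rfl

end basics

end part1

section part2
open FreeGroup

section leaf
variable {r : ℕ}

/-- elements whose reduced word has prefix `l` -/
def PC (l : List (Fin r × Bool)) : Set (FreeGroup (Fin r)) := {g | l <+: g.toWord}

/-- `S` is, up to a finite set, inside or outside `A` -/
def Mono (A S : Set (FreeGroup (Fin r))) : Prop := (S \ A).Finite ∨ (S ∩ A).Finite

lemma mem_tr_HC (u : FreeGroup (Fin r)) (a : Fin r × Bool) (h : FreeGroup.IsReduced (u.toWord ++ [a])) :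
    tr u (HC a) = PC (u.toWord ++ [a]) := by
  ext g
  constructor
  · intro hg
    obtain ⟨t, ht⟩ : ∃ t, (u⁻¹ * g).toWord = a :: t := by
      have hg' : (u⁻¹ * g).toWord.head? = some a := hg
      rcases hw : (u⁻¹ * g).toWord with _ | ⟨b, t⟩
      · simp [hw] at hg'
      · rw [hw] at hg'; simp at hg'; exact ⟨t, by rw [hg']⟩
    have hr : FreeGroup.IsReduced (u.toWord ++ (u⁻¹ * g).toWord) := by
      rw [ht]
      have h2 : FreeGroup.IsReduced ([a] ++ t) := by
        have := isReduced_toWord (x := u⁻¹ * g); rwa [ht] at this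
      simpa using h.append_overlap h2 (by simp)
    have := toWord_mul_red hr
    rw [mul_inv_cancel_left, ht] at this
    exact ⟨t, by rw [this]; simp⟩
  · rintro ⟨t, ht⟩
    have hr : FreeGroup.IsReduced (a :: t) := by
      have := isReduced_toWord (x := g)
      rw [← ht] at this
      exact this.infix ⟨u.toWord, [], by simp⟩
    have e : u⁻¹ * g = mk (a :: t) := by
      rw [inv_mul_eq_iff_eq_mul]
      conv_lhs => rw [← mk_toWord (x := g), ← ht]
      conv_rhs => rw [← mk_toWord (x := u)]
      rw [mul_mk]; simp
    simp [tr, HC, e, toWord_mk_red hr]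

lemma FC.exists_bound {A : Set (FreeGroup (Fin r))} (h : FC A) :
    ∃ R : ℕ, ∀ l : List (Fin r × Bool), FreeGroup.IsReduced l → R ≤ l.length → Mono A (PC l) := by
  have hfin : (⋃ x : Fin r × Bool, DS A (mk [x])).Finite := Set.finite_iUnion h
  obtain ⟨R, hR⟩ := (hfin.image (fun g => g.toWord.length)).bddAbove
  refine ⟨R + 1, fun l hl hlen => ?_⟩
  have key : ∀ t : List (Fin r × Bool), FreeGroup.IsReduced (l ++ t) →
      (mk (l ++ t) ∈ A ↔ mk l ∈ A) := by
    intro t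
    induction t using List.reverseRecOn with
    | nil => simp
    | append_singleton t x ih =>
      intro ht
      have ht' : FreeGroup.IsReduced (l ++ t) := ht.infix ⟨[], [x], by simp⟩
      rw [← ih ht']
      by_contra hcon
      have : (mk (l ++ t) : FreeGroup (Fin r)) ∈ ⋃ x : Fin r × Bool, DS A (mk [x]) := by
        refine Set.mem_iUnion.2 ⟨x, ?_⟩
        simp only [DS, Set.mem_ofPred_eq, mul_mk]
        rw [List.append_assoc]
        tauto
      have := hR ⟨_, this, rfl⟩
      simp only [toWord_mk_red ht', List.length_append] at this
      omega
  have key2 : ∀ g ∈ PC l, (g ∈ A ↔ mk l ∈ A) := by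
    rintro g ⟨t, ht⟩
    have := key t (by rw [ht]; exact isReduced_toWord)
    rwa [ht, mk_toWord] at this
  by_cases hA : mk l ∈ A
  · left
    convert Set.finite_empty
    ext g
    simp only [Set.mem_sdiff, Set.mem_empty_iff_false, iff_false, not_and, not_not]
    intro hg; exact (key2 g hg).2 hA
  · right
    convert Set.finite_empty
    ext g
    simp only [Set.mem_inter_iff, Set.mem_empty_iff_false, iff_false, not_and]
    intro hg; rw [key2 g hg]; exact hA

lemma PC_subset (v : FreeGroup (Fin r)) :
    PC v.toWord ⊆ {v} ∪ ⋃ b : {b : Fin r × Bool // FreeGroup.IsReduced (v.toWord ++ [b])},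
      PC (v.toWord ++ [b.1]) := by
  rintro g ⟨t, ht⟩
  rcases t with _ | ⟨b, t⟩
  · left
    simp only [List.append_nil] at ht
    exact (toWord_injective ht).symm
  · right
    refine Set.mem_iUnion.2 ⟨⟨b, ?_⟩, ⟨t, by simpa using ht⟩⟩
    have := isReduced_toWord (x := g)
    rw [← ht] at this
    exact this.infix ⟨[], t, by simp⟩

/-- existence of a deepest non-monochromatic cone below a given one -/
lemma exists_leaf {A : Set (FreeGroup (Fin r))} (h : FC A) (l : List (Fin r × Bool))
    (hl : FreeGroup.IsReduced l) (hn : ¬ Mono A (PC l)) :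
    ∃ v : FreeGroup (Fin r), l <+: v.toWord ∧
      (∀ b, FreeGroup.IsReduced (v.toWord ++ [b]) → Mono A (PC (v.toWord ++ [b]))) ∧
      (∃ b, FreeGroup.IsReduced (v.toWord ++ [b]) ∧ (PC (v.toWord ++ [b]) ∩ A).Finite) ∧
      (∃ b, FreeGroup.IsReduced (v.toWord ++ [b]) ∧ ¬ (PC (v.toWord ++ [b]) ∩ A).Finite) := by
  obtain ⟨R, hR⟩ := h.exists_bound
  let P : ℕ → Prop := fun n => ∃ v : FreeGroup (Fin r), l <+: v.toWord ∧ ¬ Mono A (PC v.toWord) ∧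
    v.toWord.length = n
  have hP : P l.length := ⟨mk l, by rw [toWord_mk_red hl], by rwa [toWord_mk_red hl],
    by rw [toWord_mk_red hl]⟩
  have hbd : ∀ n, P n → n ≤ R := by
    rintro n ⟨v, -, hv, rfl⟩
    by_contra hcon
    exact hv (hR _ isReduced_toWord (by omega))
  classical
  obtain ⟨v, hv1, hv2, hv3⟩ := Nat.findGreatest_spec (P := P) (hbd _ hP) hP
  have hmono : ∀ b, FreeGroup.IsReduced (v.toWord ++ [b]) → Mono A (PC (v.toWord ++ [b])) := by
    intro b hb
    by_contra hcon
    have : P (Nat.findGreatest P R + 1) := by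
      refine ⟨mk (v.toWord ++ [b]), ?_, ?_, ?_⟩
      · rw [toWord_mk_red hb]; exact hv1.trans (List.prefix_append _ _)
      · rwa [toWord_mk_red hb]
      · rw [toWord_mk_red hb, List.length_append, hv3]; rfl
    have := Nat.le_findGreatest (hbd _ this) this
    omega
  have h1 : ∃ b, FreeGroup.IsReduced (v.toWord ++ [b]) ∧ ¬ (PC (v.toWord ++ [b]) \ A).Finite := by
    by_contra! hcon
    apply hv2
    left
    have hf : ({v} ∪ ⋃ b : {b : Fin r × Bool // FreeGroup.IsReduced (v.toWord ++ [b])},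
      (PC (v.toWord ++ [b.1]) \ A)).Finite :=
        (Set.finite_singleton v).union (Set.finite_iUnion fun b => hcon b.1 b.2)
    refine hf.subset ?_
    rintro g ⟨hg, hgA⟩
    rcases PC_subset v hg with h | h
    · exact Or.inl h
    · obtain ⟨b, hb⟩ := Set.mem_iUnion.1 h
      exact Or.inr (Set.mem_iUnion.2 ⟨b, hb, hgA⟩)
  have h2 : ∃ b, FreeGroup.IsReduced (v.toWord ++ [b]) ∧ ¬ (PC (v.toWord ++ [b]) ∩ A).Finite := by
    by_contra! hcon
    apply hv2
    right
    have hf : ({v} ∪ ⋃ b : {b : Fin r × Bool // FreeGroup.IsReduced (v.toWord ++ [b])},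
      (PC (v.toWord ++ [b.1]) ∩ A)).Finite :=
        (Set.finite_singleton v).union (Set.finite_iUnion fun b => hcon b.1 b.2)
    refine hf.subset ?_
    rintro g ⟨hg, hgA⟩
    rcases PC_subset v hg with h | h
    · exact Or.inl h
    · obtain ⟨b, hb⟩ := Set.mem_iUnion.1 h
      exact Or.inr (Set.mem_iUnion.2 ⟨b, hb, hgA⟩)
  refine ⟨v, hv1, hmono, ?_, h2⟩
  obtain ⟨b, hb1, hb2⟩ := h1
  exact ⟨b, hb1, (hmono b hb1).resolve_left hb2⟩

end leaf

end part2

section part3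
open FreeGroup

section turns
variable {r : ℕ}

/-- position predicate for the ordered pair `x y` at cyclic position `j` of the list `W` -/
def At (W : List (Fin r × Bool)) (x y : Fin r × Bool) (j : ℕ) : Prop :=
  W[j % W.length]? = some x ∧ W[(j + 1) % W.length]? = some y

instance (W : List (Fin r × Bool)) (x y : Fin r × Bool) : DecidablePred (At W x y) :=
  fun _ => inferInstanceAs (Decidable (_ ∧ _))

/-- cyclic count of the consecutive pair `x y` in `W` -/
def cc (W : List (Fin r × Bool)) (x y : Fin r × Bool) : ℕ := Nat.count (At W x y) W.length

lemma count_mul (W : List (Fin r × Bool)) (x y : Fin r × Bool) (Q : ℕ) :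
    Nat.count (At W x y) (Q * W.length) = Q * cc W x y := by
  induction Q with
  | zero => simp
  | succ Q ih =>
    rw [Nat.succ_mul, Nat.count_add, ih, Nat.succ_mul, cc]
    congr 1
    congr 1
    · ext k
      simp only [At]
      rw [add_assoc, Nat.mul_add_mod', Nat.mul_add_mod']

lemma getElem?_flatten (W : List (Fin r × Bool)) (Q j : ℕ) (hj : j < Q * W.length) :
    (List.replicate Q W).flatten[j]? = W[j % W.length]? := by
  induction Q generalizing j with
  | zero => simp at hj
  | succ Q ih =>
    rw [List.replicate_succ, List.flatten_cons]
    by_cases h : j < W.length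
    · rw [List.getElem?_append_left h, Nat.mod_eq_of_lt h]
    · push Not at h
      rw [List.getElem?_append_right h, ih _ (by rw [Nat.succ_mul] at hj; omega),
        ← Nat.mod_eq_sub_mod h]

lemma cyc_iff (w : FreeGroup (Fin r)) : CyclicallyReduced w ↔ IsCyclicallyReduced w.toWord := by
  unfold CyclicallyReduced
  rw [isCyclicallyReduced_iff]
  simp only [isReduced_toWord, true_and]
  constructor
  · intro h a ha b hb
    rw [rel_iff]; exact h b hb a ha
  · intro h a ha b hb
    have := h b hb a ha
    rw [rel_iff] at this; exact this

lemma toWord_pow_cyc {w : FreeGroup (Fin r)} (hw : CyclicallyReduced w) (Q : ℕ) :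
    (w ^ Q).toWord = (List.replicate Q w.toWord).flatten := by
  rw [toWord_pow]
  exact (((cyc_iff w).1 hw).flatten_replicate Q).isReduced.reduce_eq

lemma turn_count {w : FreeGroup (Fin r)} (hw : CyclicallyReduced w) (Q : ℕ) (a b : Fin r × Bool) :
    ∃ T : Finset (FreeGroup (Fin r)), (∀ g ∈ T, g ∈ HC a ∧ g * w ^ Q ∈ HC b) ∧
      Q * cc w.toWord (linv a) b ≤ T.card + 1 := by
  classical
  set W := w.toWord with hW
  set Z := (w ^ Q).toWord with hZ
  have hZe : Z = (List.replicate Q W).flatten := toWord_pow_cyc hw Q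
  have hZlen : Z.length = Q * W.length := by rw [hZe]; simp
  have hZr : FreeGroup.IsReduced Z := isReduced_toWord
  let f : ℕ → FreeGroup (Fin r) := fun j => (mk (Z.take (j + 1)))⁻¹
  have hfw : ∀ j, (f j).toWord = invRev (Z.take (j + 1)) := fun j => by
    simp only [f]
    rw [toWord_inv, toWord_mk_red (hZr.infix (List.take_prefix _ _).isInfix)]
  let S := (Finset.range (Q * W.length - 1)).filter (At W (linv a) b)
  have hinj : Set.InjOn f S := by
    intro j hj k hk hjk
    have := congrArg (fun g => g.toWord.length) hjk
    simp only [hfw, invRev_length, List.length_take, hZlen] at this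
    simp only [S, Finset.coe_filter, Finset.mem_range, Set.mem_ofPred_eq] at hj hk
    omega
  refine ⟨S.image f, ?_, ?_⟩
  · intro g hg
    obtain ⟨j, hj, rfl⟩ := Finset.mem_image.1 hg
    simp only [S, Finset.mem_filter, Finset.mem_range, At] at hj
    obtain ⟨hj1, hj2, hj3⟩ := hj
    rw [← getElem?_flatten W Q j (by omega), ← hZe] at hj2
    rw [← getElem?_flatten W Q (j + 1) (by omega), ← hZe] at hj3
    constructor
    · simp only [HC, Set.mem_ofPred_eq, hfw, invRev, List.head?_reverse, List.getLast?_map]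
      rw [List.getLast?_take]
      simp [hj2, linv]
    · have : f j * w ^ Q = mk (Z.drop (j + 1)) := by
        simp only [f]
        rw [inv_mul_eq_iff_eq_mul, mul_mk, List.take_append_drop, hZ, mk_toWord]
      simp only [HC, Set.mem_ofPred_eq, this,
        toWord_mk_red (hZr.infix (List.drop_suffix _ _).isInfix), List.head?_drop, hj3]
  · rw [Finset.card_image_of_injOn hinj, ← count_mul]
    simp only [S]
    rw [← Nat.count_eq_card_filter_range]
    rcases Nat.eq_zero_or_pos (Q * W.length) with h | h
    · rw [h]; simp
    · obtain ⟨m, hm⟩ := Nat.exists_eq_succ_of_ne_zero h.ne'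
      rw [hm, Nat.count_succ]
      simp only [Nat.succ_eq_add_one, Nat.add_sub_cancel]
      split_ifs <;> omega

/-- general lower bound for crossing numbers by turns -/
lemma lower_bound {w : FreeGroup (Fin r)} (hw : CyclicallyReduced w)
    {A : Set (FreeGroup (Fin r))} (hA : FC A)
    (I : Finset (FreeGroup (Fin r) × (Fin r × Bool) × (Fin r × Bool)))
    (h1 : ∀ t ∈ I, ((tr t.1 (HC t.2.1) \ A).Finite ∧ (tr t.1 (HC t.2.2) ∩ A).Finite) ∨
      ((tr t.1 (HC t.2.1) ∩ A).Finite ∧ (tr t.1 (HC t.2.2) \ A).Finite))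
    (h2 : ∀ t ∈ I, ∀ s ∈ I, t ≠ s → Disjoint (tr t.1 (HC t.2.1)) (tr s.1 (HC s.2.1)) ∨
      Disjoint (tr t.1 (HC t.2.2)) (tr s.1 (HC s.2.2))) :
    ∃ c : ℕ, ∀ Q : ℕ, Q * ∑ t ∈ I, cc w.toWord (linv t.2.1) t.2.2 ≤ (DS A (w ^ Q)).ncard + c := by
  classical
  choose T hT1 hT2 using fun (Q : ℕ) (a b : Fin r × Bool) => turn_count hw Q a b
  let E : Set (FreeGroup (Fin r)) := ⋃ t ∈ I,
    {g | ((tr t.1 (HC t.2.1) \ A).Finite ∧ g ∈ tr t.1 (HC t.2.1) \ A) ∨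
      ((tr t.1 (HC t.2.1) ∩ A).Finite ∧ g ∈ tr t.1 (HC t.2.1) ∩ A) ∨
      ((tr t.1 (HC t.2.2) \ A).Finite ∧ g ∈ tr t.1 (HC t.2.2) \ A) ∨
      ((tr t.1 (HC t.2.2) ∩ A).Finite ∧ g ∈ tr t.1 (HC t.2.2) ∩ A)}
  have aux : ∀ S : Set (FreeGroup (Fin r)), {g | S.Finite ∧ g ∈ S}.Finite := by
    intro S
    by_cases hS : S.Finite
    · exact hS.subset fun g hg => hg.2
    · convert Set.finite_empty; ext g; simp [hS]
  have hE : E.Finite := by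
    refine I.finite_toSet.biUnion fun t _ => ?_
    exact (aux _).union ((aux _).union ((aux _).union (aux _)))
  refine ⟨2 * E.ncard + I.card, fun Q => ?_⟩
  let V : Finset (FreeGroup (Fin r)) := I.biUnion fun t => (T Q t.2.1 t.2.2).image (fun g => t.1 * g)
  have hmem : ∀ t : FreeGroup (Fin r) × (Fin r × Bool) × (Fin r × Bool), ∀ g ∈ (T Q t.2.1 t.2.2).image (fun g => t.1 * g),
      g ∈ tr t.1 (HC t.2.1) ∧ g * w ^ Q ∈ tr t.1 (HC t.2.2) := by
    intro t g hg
    obtain ⟨k, hk, rfl⟩ := Finset.mem_image.1 hg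
    have := hT1 Q _ _ k hk
    simp only [tr, Set.mem_ofPred_eq, ← mul_assoc, inv_mul_cancel, one_mul]
    simpa [mul_assoc] using this
  have hVcard : V.card = ∑ t ∈ I, (T Q t.2.1 t.2.2).card := by
    rw [Finset.card_biUnion]
    · refine Finset.sum_congr rfl fun t _ => ?_
      rw [Finset.card_image_of_injective _ (mul_right_injective _)]
    · intro t ht s hs hts
      simp only [Function.onFun]
      rw [Finset.disjoint_left]
      intro g hg hg'
      rcases h2 t ht s hs hts with h | h
      · exact Set.disjoint_left.1 h (hmem t g hg).1 (hmem s g hg').1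
      · exact Set.disjoint_left.1 h (hmem t g hg).2 (hmem s g hg').2
  have hsub : (V : Set (FreeGroup (Fin r))) ⊆ DS A (w ^ Q) ∪ (E ∪ (fun g => g * (w ^ Q)⁻¹) '' E) := by
    intro g hg
    obtain ⟨t, ht, hgt⟩ := Finset.mem_biUnion.1 (Finset.mem_coe.1 hg)
    obtain ⟨hg1, hg2⟩ := hmem t g hgt
    by_cases he1 : g ∈ E
    · exact Or.inr (Or.inl he1)
    by_cases he2 : g * w ^ Q ∈ E
    · exact Or.inr (Or.inr ⟨_, he2, by simp⟩)
    left
    simp only [E, Set.mem_iUnion, not_exists] at he1 he2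
    have e1 := he1 t ht
    have e2 := he2 t ht
    simp only [Set.mem_ofPred_eq, not_or] at e1 e2
    simp only [DS, Set.mem_ofPred_eq]
    rcases h1 t ht with ⟨f1, f2⟩ | ⟨f1, f2⟩
    · have i1 : g ∈ A := by
        by_contra hgA
        exact e1.1 ⟨f1, hg1, hgA⟩
      have i2 : g * w ^ Q ∉ A := fun hgA => e2.2.2.2 ⟨f2, hg2, hgA⟩
      exact fun h => i2 (h.1 i1)
    · have i1 : g * w ^ Q ∈ A := by
        by_contra hgA
        exact e2.2.2.1 ⟨f2, hg2, hgA⟩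
      have i2 : g ∉ A := fun hgA => e1.2.1 ⟨f1, hg1, hgA⟩
      exact fun h => i2 (h.2 i1)
  have hf : (DS A (w ^ Q) ∪ (E ∪ (fun g => g * (w ^ Q)⁻¹) '' E)).Finite :=
    (hA.finite _).union (hE.union (hE.image _))
  have c1 := Set.ncard_le_ncard hsub hf
  rw [Set.ncard_coe_finset, hVcard] at c1
  have c2 := Set.ncard_union_le (DS A (w ^ Q)) (E ∪ (fun g => g * (w ^ Q)⁻¹) '' E)
  have c3 := Set.ncard_union_le E ((fun g => g * (w ^ Q)⁻¹) '' E)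
  have c4 := Set.ncard_image_le (f := fun g => g * (w ^ Q)⁻¹) hE
  have c5 : Q * ∑ t ∈ I, cc w.toWord (linv t.2.1) t.2.2 ≤ ∑ t ∈ I, ((T Q t.2.1 t.2.2).card + 1) := by
    rw [Finset.mul_sum]
    exact Finset.sum_le_sum fun t _ => hT2 Q _ _
  rw [Finset.sum_add_distrib] at c5
  simp only [Finset.sum_const, smul_eq_mul, mul_one] at c5
  omega

end turns

end part3

section part4
open FreeGroup

section mainlemma
variable {r : ℕ}

/-- count of the (unoriented) turn `{a, b}` -/
def tt (W : List (Fin r × Bool)) (a b : Fin r × Bool) : ℕ := cc W (linv a) b + cc W (linv b) a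

/-- all turns at a given letter -/
def NN (W : List (Fin r × Bool)) (a : Fin r × Bool) : ℕ := ∑ b ∈ Finset.univ.erase a, tt W a b

/-- number of positions where letter `x` occurs -/
def pos (W : List (Fin r × Bool)) (x : Fin r × Bool) : ℕ :=
  ∑ j ∈ Finset.range W.length, if W[j % W.length]? = some x then 1 else 0

lemma cc_eq_sum (W : List (Fin r × Bool)) (x y : Fin r × Bool) :
    cc W x y = ∑ j ∈ Finset.range W.length, if At W x y j then 1 else 0 := by
  rw [cc, Nat.count_eq_card_filter_range, Finset.card_filter]

lemma exists_getElem? (W : List (Fin r × Bool)) (j : ℕ) (h : 0 < W.length) :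
    ∃ z, W[j % W.length]? = some z :=
  ⟨W[j % W.length]'(Nat.mod_lt _ h), List.getElem?_eq_getElem _⟩

lemma sum_cc_right (W : List (Fin r × Bool)) (x : Fin r × Bool) : ∑ y, cc W x y = pos W x := by
  simp only [cc_eq_sum]
  rw [Finset.sum_comm]
  refine Finset.sum_congr rfl fun j hj => ?_
  obtain ⟨z, hz⟩ := exists_getElem? W (j + 1) (by have := Finset.mem_range.1 hj; omega)
  simp only [At, hz]
  by_cases h : W[j % W.length]? = some x <;> simp [h]

lemma sum_cc_left (W : List (Fin r × Bool)) (x : Fin r × Bool) : ∑ y, cc W y x = pos W x := by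
  have h1 : ∑ y, cc W y x = ∑ j ∈ Finset.range W.length,
      if W[(j + 1) % W.length]? = some x then 1 else 0 := by
    simp only [cc_eq_sum]
    rw [Finset.sum_comm]
    refine Finset.sum_congr rfl fun j hj => ?_
    obtain ⟨z, hz⟩ := exists_getElem? W j (by have := Finset.mem_range.1 hj; omega)
    simp only [At, hz]
    by_cases h : W[(j + 1) % W.length]? = some x <;> simp [h]
  rw [h1, pos]
  have e1 := Finset.sum_range_succ (fun j => if W[j % W.length]? = some x then 1 else 0) W.length
  have e2 := Finset.sum_range_succ' (fun j => if W[j % W.length]? = some x then 1 else 0) W.length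
  rw [e1] at e2
  have e3 : (if W[W.length % W.length]? = some x then 1 else 0)
      = (if W[0 % W.length]? = some x then 1 else 0) :=
    congrArg (fun k => if W[k]? = some x then 1 else 0) (by simp)
  rw [e3] at e2
  exact (Nat.add_right_cancel e2).symm

lemma cc_inv_zero {W : List (Fin r × Bool)} (hW : IsCyclicallyReduced W) (x : Fin r × Bool) :
    cc W (linv x) x = 0 := by
  rw [cc_eq_sum]
  refine Finset.sum_eq_zero fun j hj => ?_
  rw [Finset.mem_range] at hj
  rw [if_neg]
  rintro ⟨h1, h2⟩
  have hr := (hW.flatten_replicate 2).isReduced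
  set Z := (List.replicate 2 W).flatten with hZ
  have hlen : Z.length = 2 * W.length := by simp [hZ]; ring
  rw [← getElem?_flatten W 2 j (by omega), ← hZ] at h1
  rw [← getElem?_flatten W 2 (j + 1) (by omega), ← hZ] at h2
  rw [FreeGroup.IsReduced, List.isChain_iff_getElem] at hr
  have := hr j (by omega)
  rw [rel_iff] at this
  rw [List.getElem?_eq_getElem (by omega), Option.some.injEq] at h1 h2
  rw [h1, h2, linv_linv] at this
  exact this rfl

lemma linv_bij : Function.Bijective (linv : Fin r × Bool → Fin r × Bool) :=
  Function.bijective_iff_has_inverse.2 ⟨linv, linv_linv, linv_linv⟩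

lemma NN_eq {W : List (Fin r × Bool)} (hW : IsCyclicallyReduced W) (a : Fin r × Bool) :
    NN W a = pos W (linv a) + pos W a := by
  have h0 : tt W a a = 0 := by simp [tt, cc_inv_zero hW]
  have h1 : NN W a = ∑ b, tt W a b := by
    rw [NN, ← Finset.add_sum_erase _ _ (Finset.mem_univ a), h0, zero_add]
  rw [h1]
  simp only [tt, Finset.sum_add_distrib]
  rw [sum_cc_right, ← sum_cc_left W a]
  congr 1
  exact linv_bij.sum_comp (fun y => cc W y a)

lemma sum_NN {W : List (Fin r × Bool)} (hW : IsCyclicallyReduced W) :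
    ∑ i, NN W (i, true) = W.length := by
  have : ∀ i : Fin r, NN W (i, true) = ∑ b : Bool, pos W (i, b) := fun i => by
    rw [NN_eq hW]; simp [linv, add_comm]
  simp only [this]
  rw [← Fintype.sum_prod_type' (f := fun i b => pos W (i, b))]
  simp only [pos]
  rw [Finset.sum_comm]
  have : ∀ j ∈ Finset.range W.length, (∑ y : Fin r × Bool,
      if W[j % W.length]? = some (y.1, y.2) then 1 else 0) = 1 := by
    intro j hj
    obtain ⟨z, hz⟩ := exists_getElem? W j (by have := Finset.mem_range.1 hj; omega)
    simp [hz]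
  rw [Finset.sum_congr rfl this]; simp

/-- oriented pairs separated by a splitting -/
def pairs (P R : Finset (Fin r × Bool)) : Finset ((Fin r × Bool) × (Fin r × Bool)) :=
  P ×ˢ R ∪ R ×ˢ P

lemma sum_pairs (W : List (Fin r × Bool)) {P R : Finset (Fin r × Bool)} (h : Disjoint P R) :
    ∑ t ∈ pairs P R, cc W (linv t.1) t.2 = ∑ a ∈ P, ∑ b ∈ R, tt W a b := by
  rw [pairs, Finset.sum_union]
  · rw [Finset.sum_product, Finset.sum_product_right]
    simp only [tt, Finset.sum_add_distrib]
  · rw [Finset.disjoint_left]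
    rintro ⟨a, b⟩ h1 h2
    rw [Finset.mem_product] at h1 h2
    exact Finset.disjoint_left.1 h h1.1 h2.1

lemma le_sum_pairs {W : List (Fin r × Bool)} {m : ℕ} (hm : ∀ a b, a ≠ b → m ≤ tt W a b)
    {P R : Finset (Fin r × Bool)} (h : Disjoint P R) :
    P.card * R.card * m ≤ ∑ t ∈ pairs P R, cc W (linv t.1) t.2 := by
  rw [sum_pairs W h]
  have : ∑ a ∈ P, ∑ b ∈ R, m ≤ ∑ a ∈ P, ∑ b ∈ R, tt W a b := by
    refine Finset.sum_le_sum fun a ha => Finset.sum_le_sum fun b hb => hm a b ?_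
    rintro rfl
    exact Finset.disjoint_left.1 h ha hb
  simpa [mul_assoc] using this

lemma HC_disjoint {a b : Fin r × Bool} (h : a ≠ b) : Disjoint (HC a) (HC b) := by
  rw [Set.disjoint_left]
  intro g h1 h2
  simp only [HC, Set.mem_ofPred_eq] at h1 h2
  rw [h1] at h2
  exact h (by simpa using h2)

lemma tr_disjoint {S T : Set (FreeGroup (Fin r))} (u : FreeGroup (Fin r)) (h : Disjoint S T) :
    Disjoint (tr u S) (tr u T) := by
  rw [Set.disjoint_left] at *
  intro g h1 h2
  exact h h1 h2

lemma same_vertex {u : FreeGroup (Fin r)} {p q : (Fin r × Bool) × (Fin r × Bool)} (h : p ≠ q) :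
    Disjoint (tr u (HC p.1)) (tr u (HC q.1)) ∨ Disjoint (tr u (HC p.2)) (tr u (HC q.2)) := by
  by_cases h1 : p.1 = q.1
  · right
    exact tr_disjoint u (HC_disjoint fun h2 => h (Prod.ext h1 h2))
  · left
    exact tr_disjoint u (HC_disjoint h1)

/-- colouring condition at a vertex -/
def Good (A : Set (FreeGroup (Fin r))) (u : FreeGroup (Fin r)) (P R : Finset (Fin r × Bool)) : Prop :=
  (∀ a ∈ P, (tr u (HC a) \ A).Finite) ∧ (∀ a ∈ R, (tr u (HC a) ∩ A).Finite)

lemma Good.spec {A : Set (FreeGroup (Fin r))} {u : FreeGroup (Fin r)} {P R : Finset (Fin r × Bool)}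
    (h : Good A u P R) : ∀ t ∈ pairs P R,
      ((tr u (HC t.1) \ A).Finite ∧ (tr u (HC t.2) ∩ A).Finite) ∨
      ((tr u (HC t.1) ∩ A).Finite ∧ (tr u (HC t.2) \ A).Finite) := by
  intro t ht
  simp only [pairs, Finset.mem_union, Finset.mem_product] at ht
  rcases ht with ht | ht
  · exact Or.inl ⟨h.1 _ ht.1, h.2 _ ht.2⟩
  · exact Or.inr ⟨h.2 _ ht.1, h.1 _ ht.2⟩

lemma lower_one {w : FreeGroup (Fin r)} (hw : CyclicallyReduced w)
    {A : Set (FreeGroup (Fin r))} (hA : FC A) {u : FreeGroup (Fin r)} {P R : Finset (Fin r × Bool)}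
    (h : Good A u P R) :
    ∃ c : ℕ, ∀ Q : ℕ, Q * ∑ t ∈ pairs P R, cc w.toWord (linv t.1) t.2 ≤ (DS A (w ^ Q)).ncard + c := by
  classical
  have := lower_bound hw hA ({u} ×ˢ pairs P R) (by
    rintro ⟨v, t⟩ ht
    simp only [Finset.mem_product, Finset.mem_singleton] at ht
    obtain ⟨rfl, ht⟩ := ht
    exact h.spec t ht) (by
    rintro ⟨v, t⟩ ht ⟨v', s⟩ hs hne
    simp only [Finset.mem_product, Finset.mem_singleton] at ht hs
    obtain ⟨rfl, ht⟩ := ht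
    obtain ⟨rfl, hs⟩ := hs
    exact same_vertex fun h => hne (Prod.ext rfl h))
  simpa [Finset.sum_product] using this

lemma lower_two {w : FreeGroup (Fin r)} (hw : CyclicallyReduced w)
    {A : Set (FreeGroup (Fin r))} (hA : FC A) {v : FreeGroup (Fin r)}
    {P R P' R' : Finset (Fin r × Bool)} {a0 : Fin r × Bool}
    (h : Good A 1 P R) (h' : Good A v P' R') (hP : a0 ∉ P) (hR : a0 ∉ R) (hv : v ≠ 1)
    (hP' : ∀ a ∈ P', tr v (HC a) ⊆ HC a0) (hR' : ∀ a ∈ R', tr v (HC a) ⊆ HC a0) :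
    ∃ c : ℕ, ∀ Q : ℕ, Q * (∑ t ∈ pairs P R, cc w.toWord (linv t.1) t.2 +
      ∑ t ∈ pairs P' R', cc w.toWord (linv t.1) t.2) ≤ (DS A (w ^ Q)).ncard + c := by
  classical
  have hd : Disjoint ({1} ×ˢ pairs P R) ({v} ×ˢ pairs P' R') := by
    rw [Finset.disjoint_left]
    rintro ⟨x, t⟩ h1 h2
    simp only [Finset.mem_product, Finset.mem_singleton] at h1 h2
    exact hv (h2.1.symm.trans h1.1)
  have aux1 : ∀ t ∈ pairs P R, t.1 ≠ a0 := by
    intro t ht e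
    simp only [pairs, Finset.mem_union, Finset.mem_product] at ht
    rw [e] at ht
    tauto
  have aux2 : ∀ t ∈ pairs P' R', tr v (HC t.1) ⊆ HC a0 := by
    intro t ht
    simp only [pairs, Finset.mem_union, Finset.mem_product] at ht
    rcases ht with ht | ht
    · exact hP' _ ht.1
    · exact hR' _ ht.1
  have tr1 : ∀ S : Set (FreeGroup (Fin r)), tr 1 S = S := fun S => by ext g; simp [tr]
  have cross : ∀ t ∈ pairs P R, ∀ s ∈ pairs P' R', Disjoint (tr 1 (HC t.1)) (tr v (HC s.1)) := by
    intro t ht s hs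
    rw [tr1]
    exact Set.disjoint_of_subset_right (aux2 s hs) (HC_disjoint (aux1 t ht))
  have := lower_bound hw hA ({1} ×ˢ pairs P R ∪ {v} ×ˢ pairs P' R') (by
    rintro ⟨x, t⟩ ht
    simp only [Finset.mem_product, Finset.mem_singleton, Finset.mem_union] at ht
    rcases ht with ⟨rfl, ht⟩ | ⟨rfl, ht⟩
    · exact h.spec t ht
    · exact h'.spec t ht) (by
    rintro ⟨x, t⟩ ht ⟨y, s⟩ hs hne
    simp only [Finset.mem_product, Finset.mem_singleton, Finset.mem_union] at ht hs
    rcases ht with ⟨rfl, ht⟩ | ⟨rfl, ht⟩ <;> rcases hs with ⟨rfl, hs⟩ | ⟨rfl, hs⟩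
    · exact same_vertex fun h => hne (Prod.ext rfl h)
    · exact Or.inl (cross t ht s hs)
    · exact Or.inl (cross s hs t ht).symm
    · exact same_vertex fun h => hne (Prod.ext rfl h))
  rw [Finset.sum_union hd] at this
  simpa [Finset.sum_product] using this

lemma half_tree {A : Set (FreeGroup (Fin r))} {a : Fin r × Bool}
    (h1 : (HC a \ A).Finite) (h2 : ∀ b, b ≠ a → (HC b ∩ A).Finite) : Equi A (HC (a.1, true)) := by
  refine Equi.trans ?_ (Equi.HC_true a)
  refine Equi.of_fin (FC_HC a) ?_
  have hf : ({1} ∪ ((HC a \ A) ∪ ⋃ b : {b // b ≠ a}, (HC b.1 ∩ A))).Finite :=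
    (Set.finite_singleton _).union (h1.union (Set.finite_iUnion fun b => h2 b.1 b.2))
  refine hf.subset ?_
  rintro g (⟨hg1, hg2⟩ | ⟨hg1, hg2⟩)
  · rcases hw : g.toWord with _ | ⟨b, t⟩
    · exact Or.inl (toWord_eq_nil_iff.1 hw)
    · right; right
      refine Set.mem_iUnion.2 ⟨⟨b, ?_⟩, ?_, hg1⟩
      · rintro rfl; apply hg2; simp [HC, hw]
      · simp [HC, hw]
  · exact Or.inr (Or.inl ⟨hg1, hg2⟩)

lemma nonred_unique {l : List (Fin r × Bool)} (hl : FreeGroup.IsReduced l) {a b : Fin r × Bool}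
    (ha : ¬ FreeGroup.IsReduced (l ++ [a])) (hb : ¬ FreeGroup.IsReduced (l ++ [b])) : a = b := by
  have key : ∀ c, ¬ FreeGroup.IsReduced (l ++ [c]) → ∃ x, l.getLast? = some x ∧ c = linv x := by
    intro c hc
    rw [FreeGroup.IsReduced, List.isChain_append] at hc
    by_contra hcon
    push Not at hcon
    apply hc
    refine ⟨hl, List.isChain_singleton _, ?_⟩
    intro x hx y hy
    simp only [List.head?_cons, Option.mem_def, Option.some.injEq] at hy
    subst hy
    rw [rel_iff]
    exact hcon x hx
  obtain ⟨x, hx, rfl⟩ := key a ha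
  obtain ⟨y, hy, rfl⟩ := key b hb
  rw [hx] at hy
  rw [Option.some.inj hy]

lemma tr_inter_fin {A S : Set (FreeGroup (Fin r))} {u : FreeGroup (Fin r)}
    (h : (tr u S ∩ A).Finite) : (tr 1 S ∩ tr u⁻¹ A).Finite := by
  refine (h.image (fun g => u⁻¹ * g)).subset ?_
  rintro g ⟨h1, h2⟩
  refine ⟨u * g, ⟨?_, ?_⟩, by simp⟩
  · simpa [tr] using h1
  · simpa [tr] using h2

lemma tr_diff_fin {A S : Set (FreeGroup (Fin r))} {u : FreeGroup (Fin r)}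
    (h : (tr u S \ A).Finite) : (tr 1 S \ tr u⁻¹ A).Finite := by
  refine (h.image (fun g => u⁻¹ * g)).subset ?_
  rintro g ⟨h1, h2⟩
  refine ⟨u * g, ⟨?_, ?_⟩, by simp⟩
  · simpa [tr] using h1
  · simpa [tr] using h2

open Classical in
/-- the two colour classes at a leaf vertex -/
lemma leaf_good {A : Set (FreeGroup (Fin r))} {v : FreeGroup (Fin r)}
    (h1 : ∀ b, FreeGroup.IsReduced (v.toWord ++ [b]) → Mono A (PC (v.toWord ++ [b])))
    (h2 : ∃ b, FreeGroup.IsReduced (v.toWord ++ [b]) ∧ (PC (v.toWord ++ [b]) ∩ A).Finite)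
    (h3 : ∃ b, FreeGroup.IsReduced (v.toWord ++ [b]) ∧ ¬ (PC (v.toWord ++ [b]) ∩ A).Finite) :
    ∃ P R : Finset (Fin r × Bool), Disjoint P R ∧ Good A v P R ∧ 1 ≤ P.card ∧ 1 ≤ R.card ∧
      2 * r - 1 ≤ P.card + R.card ∧ (∀ a ∈ P, FreeGroup.IsReduced (v.toWord ++ [a])) ∧
      (∀ a ∈ R, FreeGroup.IsReduced (v.toWord ++ [a])) := by
  let S : Finset (Fin r × Bool) := Finset.univ.filter fun b => FreeGroup.IsReduced (v.toWord ++ [b])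
  let P := S.filter fun b => ¬ (PC (v.toWord ++ [b]) ∩ A).Finite
  let R := S.filter fun b => (PC (v.toWord ++ [b]) ∩ A).Finite
  refine ⟨P, R, ?_, ⟨?_, ?_⟩, ?_, ?_, ?_, ?_, ?_⟩
  · rw [Finset.disjoint_left]
    intro a ha hb
    exact (Finset.mem_filter.1 ha).2 (Finset.mem_filter.1 hb).2
  · intro a ha
    simp only [P, S, Finset.mem_filter, Finset.mem_univ, true_and] at ha
    rw [mem_tr_HC v a ha.1]
    exact (h1 a ha.1).resolve_right ha.2
  · intro a ha
    simp only [R, S, Finset.mem_filter, Finset.mem_univ, true_and] at ha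
    rw [mem_tr_HC v a ha.1]
    exact ha.2
  · obtain ⟨b, hb⟩ := h3
    exact Finset.card_pos.2 ⟨b, by simpa [P, S] using hb⟩
  · obtain ⟨b, hb⟩ := h2
    exact Finset.card_pos.2 ⟨b, by simpa [R, S] using hb⟩
  · have e : P.card + R.card = S.card := by
      rw [add_comm]; exact Finset.card_filter_add_card_filter_not _
    have e2 := Finset.card_filter_add_card_filter_not (s := (Finset.univ : Finset (Fin r × Bool)))
      (fun b => FreeGroup.IsReduced (v.toWord ++ [b]))
    have e3 : (Finset.univ.filter fun b : Fin r × Bool => ¬ FreeGroup.IsReduced (v.toWord ++ [b])).card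
        ≤ 1 := by
      rw [Finset.card_le_one]
      intro a ha b hb
      simp only [Finset.mem_filter, Finset.mem_univ, true_and] at ha hb
      exact nonred_unique isReduced_toWord ha hb
    have e4 : (Finset.univ : Finset (Fin r × Bool)).card = 2 * r := by simp [mul_comm]
    have e5 : S.card + (Finset.univ.filter fun b : Fin r × Bool => ¬ FreeGroup.IsReduced (v.toWord ++ [b])).card
      = (Finset.univ : Finset (Fin r × Bool)).card := e2
    omega
  · intro a ha
    simp only [P, S, Finset.mem_filter, Finset.mem_univ, true_and] at ha
    exact ha.1
  · intro a ha
    simp only [R, S, Finset.mem_filter, Finset.mem_univ, true_and] at ha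
    exact ha.1

lemma PC_singleton (a : Fin r × Bool) : PC [a] = HC a := by
  have := mem_tr_HC 1 a (by simp)
  rw [toWord_one, List.nil_append] at this
  rw [← this]; ext g; simp [tr]

end mainlemma

end part4

section part5
open FreeGroup

section determ
variable {r : ℕ}

lemma tr_one (S : Set (FreeGroup (Fin r))) : tr 1 S = S := by ext g; simp [tr]

lemma cover_fin {A : Set (FreeGroup (Fin r))} (h : ∀ b, (HC b ∩ A).Finite) : A.Finite := by
  refine ((Set.finite_singleton (1 : FreeGroup (Fin r))).union (Set.finite_iUnion h)).subset ?_
  intro g hg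
  rcases hw : g.toWord with _ | ⟨b, t⟩
  · exact Or.inl (toWord_eq_nil_iff.1 hw)
  · exact Or.inr (Set.mem_iUnion.2 ⟨b, by simp [HC, hw], hg⟩)

open Classical in
lemma case_one {w : FreeGroup (Fin r)} (hw : CyclicallyReduced w) {m : ℕ}
    (hm : ∀ a b, a ≠ b → m ≤ tt w.toWord a b)
    {A : Set (FreeGroup (Fin r))} (hA : FC A) (hi : A.Infinite) (hci : Aᶜ.Infinite)
    (hmono : ∀ a, Mono A (HC a)) :
    (∃ c : ℕ, ∀ Q : ℕ, Q * ((4 * r - 4) * m) ≤ (DS A (w ^ Q)).ncard + c) ∨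
      ∃ j, Equi A (HC (j, true)) := by
  let R : Finset (Fin r × Bool) := Finset.univ.filter fun b => (HC b ∩ A).Finite
  let P : Finset (Fin r × Bool) := Finset.univ.filter fun b => ¬ (HC b ∩ A).Finite
  have hPR : R.card + P.card = 2 * r := by
    have := Finset.card_filter_add_card_filter_not (s := (Finset.univ : Finset (Fin r × Bool)))
      (fun b => (HC b ∩ A).Finite)
    have e4 : (Finset.univ : Finset (Fin r × Bool)).card = 2 * r := by simp [mul_comm]
    rw [← e4]; exact this
  have hdis : Disjoint P R := by
    rw [Finset.disjoint_left]
    intro a ha hb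
    exact (Finset.mem_filter.1 ha).2 (Finset.mem_filter.1 hb).2
  have hPm : ∀ b, b ∈ P ↔ ¬ (HC b ∩ A).Finite := fun b => by simp [P]
  have hRm : ∀ b, b ∈ R ↔ (HC b ∩ A).Finite := fun b => by simp [R]
  have hP' : ∀ b ∈ P, (HC b \ A).Finite := fun b hb => (hmono b).resolve_right ((hPm b).1 hb)
  have hP1 : 1 ≤ P.card := by
    refine Finset.card_pos.2 ?_
    by_contra hcon
    rw [Finset.not_nonempty_iff_eq_empty] at hcon
    refine hi (cover_fin fun b => ?_)
    by_contra hb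
    have := (hPm b).2 hb
    simp [hcon] at this
  have hR1 : 1 ≤ R.card := by
    refine Finset.card_pos.2 ?_
    by_contra hcon
    rw [Finset.not_nonempty_iff_eq_empty] at hcon
    refine hci (cover_fin fun b => ?_)
    refine hP' b ((hPm b).2 fun hb => ?_)
    have := (hRm b).2 hb
    simp [hcon] at this
  by_cases p1 : P.card = 1
  · right
    obtain ⟨a, ha⟩ := Finset.card_eq_one.1 p1
    refine ⟨a.1, half_tree (hP' a (by simp [ha])) fun b hb => ?_⟩
    by_contra hc
    have := (hPm b).2 hc
    rw [ha, Finset.mem_singleton] at this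
    exact hb this
  by_cases q1 : R.card = 1
  · right
    obtain ⟨a, ha⟩ := Finset.card_eq_one.1 q1
    refine ⟨a.1, (Equi.compl A).symm.trans (half_tree ?_ fun b hb => ?_)⟩
    · rw [Set.sdiff_compl]
      exact (hRm a).1 (by simp [ha])
    · refine hP' b ((hPm b).2 fun hc => ?_)
      have := (hRm b).2 hc
      rw [ha, Finset.mem_singleton] at this
      exact hb this
  left
  have hG : Good A 1 P R := ⟨fun a ha => by rw [tr_one]; exact hP' a ha,
    fun a ha => by rw [tr_one]; exact (hRm a).1 ha⟩
  obtain ⟨c, hc⟩ := lower_one hw hA hG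
  refine ⟨c, fun Q => le_trans (Nat.mul_le_mul_left _ ?_) (hc Q)⟩
  refine le_trans (Nat.mul_le_mul_right _ ?_) (le_sum_pairs hm hdis)
  obtain ⟨x, hx⟩ := Nat.exists_eq_add_of_le (show 2 ≤ P.card by omega)
  obtain ⟨y, hy⟩ := Nat.exists_eq_add_of_le (show 2 ≤ R.card by omega)
  rw [hx, hy]
  have : (2 + x) * (2 + y) = 4 + 2 * x + 2 * y + x * y := by ring
  have h2 : 0 ≤ x * y := Nat.zero_le _
  rw [this]
  omega

lemma two_mul_bound {p q r : ℕ} (hp : 1 ≤ p) (hq : 1 ≤ q) (h : 2 * r - 1 ≤ p + q) :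
    2 * r - 2 ≤ p * q := by
  obtain ⟨x, rfl⟩ := Nat.exists_eq_add_of_le hp
  obtain ⟨y, rfl⟩ := Nat.exists_eq_add_of_le hq
  have : (1 + x) * (1 + y) = 1 + x + y + x * y := by ring
  rw [this]
  have h2 : 0 ≤ x * y := Nat.zero_le _
  omega

lemma main_lemma {w : FreeGroup (Fin r)} (hw : CyclicallyReduced w) {m : ℕ}
    (hm : ∀ a b, a ≠ b → m ≤ tt w.toWord a b)
    {A : Set (FreeGroup (Fin r))} (hA : FC A) (hi : A.Infinite) (hci : Aᶜ.Infinite) :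
    (∃ c : ℕ, ∀ Q : ℕ, Q * ((4 * r - 4) * m) ≤ (DS A (w ^ Q)).ncard + c) ∨
      ∃ j, Equi A (HC (j, true)) := by
  have hPC : PC ([] : List (Fin r × Bool)) = Set.univ := by ext g; simp [PC]
  have hn : ¬ Mono A (PC []) := by
    rw [hPC]
    rintro (h | h)
    · exact hci (by simpa [Set.compl_eq_univ_sdiff] using h)
    · exact hi (by simpa using h)
  obtain ⟨u, -, hu1, hu2, hu3⟩ := exists_leaf hA [] (by simp) hn
  obtain ⟨P, R, hd, hG, hP1, hR1, hPR, -, -⟩ := leaf_good hu1 hu2 hu3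
  have hA1 := hA.tr u⁻¹
  have hE : Equi (tr u⁻¹ A) A := Equi.tr _ _
  have hG1 : Good (tr u⁻¹ A) 1 P R := ⟨fun a ha => tr_diff_fin (hG.1 a ha),
    fun a ha => tr_inter_fin (hG.2 a ha)⟩
  suffices h : (∃ c : ℕ, ∀ Q : ℕ, Q * ((4 * r - 4) * m) ≤ (DS (tr u⁻¹ A) (w ^ Q)).ncard + c) ∨
      ∃ j, Equi (tr u⁻¹ A) (HC (j, true)) by
    rcases h with ⟨c, hc⟩ | ⟨j, hj⟩
    · left
      obtain ⟨d, hd⟩ := hE w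
      exact ⟨d + c, fun Q => by have := hc Q; have := (hd Q).1; omega⟩
    · exact Or.inr ⟨j, hE.symm.trans hj⟩
  have hinf : ∀ S : Set (FreeGroup (Fin r)), S.Infinite → (tr u⁻¹ S).Infinite := by
    intro S hS hf
    refine hS ((hf.image (fun g => u * g)).subset fun g hg => ⟨u⁻¹ * g, ?_, by simp⟩)
    simpa [tr] using hg
  have hi1 := hinf _ hi
  have hci1 : (tr u⁻¹ A)ᶜ.Infinite := hinf _ hci
  generalize tr u⁻¹ A = B at *
  clear hn hu1 hu2 hu3 hG hE hinf
  by_cases hmono : ∀ a, Mono B (HC a)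
  · exact case_one hw hm hA1 hi1 hci1 hmono
  left
  push Not at hmono
  obtain ⟨a0, ha0⟩ := hmono
  rw [← PC_singleton] at ha0
  obtain ⟨v, hv0, hv1, hv2, hv3⟩ := exists_leaf hA1 [a0] (by simp) ha0
  obtain ⟨P', R', hd', hG', hP1', hR1', hPR', hredP, hredR⟩ := leaf_good hv1 hv2 hv3
  have hsub : ∀ a, FreeGroup.IsReduced (v.toWord ++ [a]) → tr v (HC a) ⊆ HC a0 := by
    intro a ha
    rw [mem_tr_HC v a ha, ← PC_singleton]
    intro g hg
    exact (hv0.trans (List.prefix_append _ _)).trans hg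
  rw [PC_singleton] at ha0
  obtain ⟨c, hc⟩ := lower_two hw hA1 (a0 := a0) hG1 hG'
    (fun h => ha0 (Or.inl (by have := hG1.1 a0 h; rwa [tr_one] at this)))
    (fun h => ha0 (Or.inr (by have := hG1.2 a0 h; rwa [tr_one] at this)))
    (by rintro rfl; simp at hv0)
    (fun a ha => hsub a (hredP a ha)) (fun a ha => hsub a (hredR a ha))
  refine ⟨c, fun Q => le_trans (Nat.mul_le_mul_left _ ?_) (hc Q)⟩
  have h1 := le_sum_pairs hm hd
  have h2 := le_sum_pairs hm hd'
  have h3 := Nat.mul_le_mul_right m (two_mul_bound hP1 hR1 hPR)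
  have h4 := Nat.mul_le_mul_right m (two_mul_bound hP1' hR1' hPR')
  have h5 : (4 * r - 4) * m = (2 * r - 2) * m + (2 * r - 2) * m := by
    rw [← add_mul]; congr 1; omega
  omega

lemma HC_lower {w : FreeGroup (Fin r)} (hw : CyclicallyReduced w) (a : Fin r × Bool) :
    ∃ c : ℕ, ∀ Q : ℕ, Q * NN w.toWord a ≤ (DS (HC a) (w ^ Q)).ncard + c := by
  have hG : Good (HC a) 1 {a} (Finset.univ.erase a) := by
    refine ⟨fun b hb => ?_, fun b hb => ?_⟩
    · rw [Finset.mem_singleton] at hb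
      rw [hb, tr_one]; simp
    · rw [tr_one, (HC_disjoint (Finset.ne_of_mem_erase hb)).inter_eq]; simp
  have := lower_one hw (FC_HC a) hG
  rw [sum_pairs _ (by simp)] at this
  simpa [NN] using this

end determ

end part5

section part6
open FreeGroup

section determ2
variable {r : ℕ}

lemma le_of_mul_le {a b c : ℕ} (h : ∀ Q : ℕ, Q * a ≤ Q * b + c) : a ≤ b := by
  by_contra hlt
  push Not at hlt
  have h1 := h (c + 1)
  have h2 : (c + 1) * (b + 1) ≤ (c + 1) * a := Nat.mul_le_mul_left _ hlt
  rw [mul_add] at h2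
  omega

/-- pullback of the cone -/
def AA (α : FreeGroup (Fin r) ≃* FreeGroup (Fin r)) (i : Fin r) : Set (FreeGroup (Fin r)) :=
  {g | α g ∈ HC (i, true)}

lemma DS_AA (α : FreeGroup (Fin r) ≃* FreeGroup (Fin r)) (i : Fin r) (v : FreeGroup (Fin r)) :
    DS (AA α i) v = α ⁻¹' DS (HC (i, true)) (α v) := by
  ext g; simp [DS, AA]

lemma ncard_DS_AA (α : FreeGroup (Fin r) ≃* FreeGroup (Fin r)) (i : Fin r) (v : FreeGroup (Fin r)) :
    (DS (AA α i) v).ncard = (DS (HC (i, true)) (α v)).ncard := by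
  rw [DS_AA]
  have : α ⁻¹' DS (HC (i, true)) (α v) = α.symm '' DS (HC (i, true)) (α v) := by
    ext g
    constructor
    · intro h; exact ⟨α g, h, by simp⟩
    · rintro ⟨x, hx, rfl⟩; simpa using hx
  rw [this, Set.ncard_image_of_injective _ α.symm.injective]

lemma FC_AA (α : FreeGroup (Fin r) ≃* FreeGroup (Fin r)) (i : Fin r) : FC (AA α i) := fun x => by
  rw [DS_AA]
  exact ((FC_HC _).finite _).preimage (α.injective.injOn)

lemma toWord_of_pow' (i : Fin r) (n : ℕ) : ((FreeGroup.of i) ^ n).toWord = List.replicate n (i, true) :=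
  FreeGroup.toWord_of_pow i n

lemma of_pow_mem (i : Fin r) (n : ℕ) : (FreeGroup.of i) ^ (n + 1) ∈ HC (i, true) := by
  simp [HC, toWord_of_pow', List.replicate_succ]

lemma of_pow_notMem (i : Fin r) (n : ℕ) : ((FreeGroup.of i) ^ n)⁻¹ ∉ HC (i, true) := by
  simp [HC, toWord_inv, toWord_of_pow', invRev, List.head?_replicate]

lemma of_pow_inj (i : Fin r) : Function.Injective fun n : ℕ => (FreeGroup.of i) ^ n := by
  intro a b h
  have := congrArg (fun g => g.toWord.length) h
  simpa [toWord_of_pow'] using this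

lemma AA_inf (α : FreeGroup (Fin r) ≃* FreeGroup (Fin r)) (i : Fin r) : (AA α i).Infinite := by
  refine Set.infinite_of_injective_forall_mem (f := fun n : ℕ => α.symm ((FreeGroup.of i) ^ (n + 1))) ?_ ?_
  · intro a b h
    have := of_pow_inj i (α.symm.injective h)
    omega
  · intro n
    simp only [AA, Set.mem_ofPred_eq, MulEquiv.apply_symm_apply]
    exact of_pow_mem i n

lemma AA_coinf (α : FreeGroup (Fin r) ≃* FreeGroup (Fin r)) (i : Fin r) : (AA α i)ᶜ.Infinite := by
  refine Set.infinite_of_injective_forall_mem (f := fun n : ℕ => α.symm (((FreeGroup.of i) ^ n)⁻¹)) ?_ ?_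
  · intro a b h
    exact of_pow_inj i (inv_injective (α.symm.injective h))
  · intro n
    simp only [AA, Set.mem_compl_iff, Set.mem_ofPred_eq, MulEquiv.apply_symm_apply]
    exact of_pow_notMem i n

lemma DS_of_pow (i : Fin r) (Q : ℕ) : Q ≤ (DS (HC (i, true)) ((FreeGroup.of i) ^ Q)).ncard := by
  have hsub : (fun n : ℕ => ((FreeGroup.of i) ^ n)⁻¹) '' (Finset.range Q : Set ℕ) ⊆
      DS (HC (i, true)) ((FreeGroup.of i) ^ Q) := by
    rintro _ ⟨n, hn, rfl⟩
    have hn : n < Q := by simpa using hn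
    obtain ⟨k, rfl⟩ := Nat.exists_eq_add_of_lt hn
    simp only [DS, Set.mem_ofPred_eq]
    have e : ((FreeGroup.of i) ^ n)⁻¹ * (FreeGroup.of i) ^ (n + k + 1) = (FreeGroup.of i) ^ (k + 1) := by
      rw [add_assoc, pow_add]; simp
    rw [e]
    intro h
    exact of_pow_notMem i n (h.2 (of_pow_mem i k))
  have := Set.ncard_le_ncard hsub ((FC_HC _).finite _)
  rw [Set.ncard_image_of_injective _ (fun a b h => of_pow_inj i (inv_injective h)),
    Set.ncard_coe_finset, Finset.card_range] at this
  exact this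

lemma AA_not_equi (α : FreeGroup (Fin r) ≃* FreeGroup (Fin r)) {i k : Fin r} (hik : i ≠ k) :
    ¬ Equi (AA α i) (AA α k) := by
  intro h
  obtain ⟨c, hc⟩ := h (α.symm (FreeGroup.of i))
  have h1 := (hc (c + 1)).1
  rw [ncard_DS_AA, ncard_DS_AA] at h1
  simp only [map_pow, MulEquiv.apply_symm_apply] at h1
  have h2 := DS_of_pow i (c + 1)
  have h3 := D_HC_pow k (FreeGroup.of i) (c + 1)
  have h4 : occ k (FreeGroup.of i).toWord = 0 := by simp [occ, hik]
  rw [h4] at h3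
  omega

/-- the balance condition -/
def Bal (W : List (Fin r × Bool)) : Prop :=
  ∀ a b c d : Fin r × Bool, a ≠ b → c ≠ d → 3 * tt W a b ≤ 4 * tt W c d

lemma Bal.len_le (hr : 2 ≤ r) {w : FreeGroup (Fin r)} (hw : CyclicallyReduced w) (hB : Bal w.toWord)
    (α : FreeGroup (Fin r) ≃* FreeGroup (Fin r)) : len w ≤ len (α w) := by
  classical
  -- minimum of the turn counts
  let S : Finset ((Fin r × Bool) × (Fin r × Bool)) := Finset.univ.filter fun p => p.1 ≠ p.2
  have hS : S.Nonempty := ⟨((⟨0, by omega⟩, true), (⟨0, by omega⟩, false)), by simp [S]⟩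
  obtain ⟨p, hp, hmin⟩ := S.exists_min_image (fun p => tt w.toWord p.1 p.2) hS
  have hp' : p.1 ≠ p.2 := by simpa [S] using hp
  set m := tt w.toWord p.1 p.2 with hmdef
  have hm : ∀ a b, a ≠ b → m ≤ tt w.toWord a b := fun a b hab => hmin (a, b) (by simpa [S] using hab)
  have hNN : ∀ a, NN w.toWord a ≤ (4 * r - 4) * m := by
    intro a
    have h1 : 3 * NN w.toWord a ≤ ∑ b ∈ Finset.univ.erase a, 4 * m := by
      rw [NN, Finset.mul_sum]
      refine Finset.sum_le_sum fun b hb => hB _ _ _ _ (Finset.ne_of_mem_erase hb).symm hp'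
    rw [Finset.sum_const, Finset.card_erase_of_mem (Finset.mem_univ _)] at h1
    have e4 : (Finset.univ : Finset (Fin r × Bool)).card = 2 * r := by simp [mul_comm]
    rw [e4, smul_eq_mul] at h1
    have h2 : (2 * r - 1) * (4 * m) ≤ (3 * (4 * r - 4)) * m := by
      rw [← mul_assoc]
      exact Nat.mul_le_mul_right _ (by omega)
    rw [mul_assoc] at h2
    omega
  let J : Finset (Fin r) := Finset.univ.filter fun i => ∃ j, Equi (AA α i) (HC (j, true))
  have hJ : ∀ i, ∃ j, i ∈ J → Equi (AA α i) (HC (j, true)) := by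
    intro i
    by_cases h : i ∈ J
    · obtain ⟨j, hj⟩ := (Finset.mem_filter.1 h).2
      exact ⟨j, fun _ => hj⟩
    · exact ⟨i, fun h' => absurd h' h⟩
  choose σ hσ using hJ
  have hinj : Set.InjOn σ J := by
    intro i hi k hk hik
    by_contra hne
    have h1 := hσ i hi
    rw [hik] at h1
    exact AA_not_equi α hne (h1.trans (hσ k hk).symm)
  let val : Fin r → ℕ := fun i => if i ∈ J then NN w.toWord (σ i, true) else (4 * r - 4) * m
  have hval : ∀ i, val i ≤ occ i (α w).toWord := by
    intro i
    have hup : ∀ Q, (DS (AA α i) (w ^ Q)).ncard ≤ Q * occ i (α w).toWord := fun Q => by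
      rw [ncard_DS_AA, map_pow]; exact D_HC_pow i (α w) Q
    by_cases h : i ∈ J
    · simp only [val, if_pos h]
      obtain ⟨c, hc⟩ := HC_lower hw (σ i, true)
      obtain ⟨d, hd⟩ := hσ i h w
      refine le_of_mul_le (c := d + c) fun Q => ?_
      have := hc Q; have := (hd Q).2; have := hup Q
      omega
    · simp only [val, if_neg h]
      rcases main_lemma hw hm (FC_AA α i) (AA_inf α i) (AA_coinf α i) with ⟨c, hc⟩ | hj
      · refine le_of_mul_le (c := c) fun Q => ?_
        have := hc Q; have := hup Q
        omega
      · exact absurd (show i ∈ J by simpa [J] using hj) h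
  have hlen : len w = ∑ i, NN w.toWord (i, true) := by
    rw [sum_NN ((cyc_iff w).1 hw)]; rfl
  have hlen2 : len (α w) = ∑ i, occ i (α w).toWord := by
    rw [sum_occ]; rfl
  rw [hlen, hlen2]
  refine le_trans ?_ (Finset.sum_le_sum fun i _ => hval i)
  have hcard : (Finset.univ \ J.image σ).card = (Finset.univ \ J).card := by
    rw [Finset.card_sdiff_of_subset (Finset.subset_univ _), Finset.card_sdiff_of_subset (Finset.subset_univ _),
      Finset.card_image_of_injOn hinj]
  rw [← Finset.sum_sdiff (Finset.subset_univ (J.image σ)), ← Finset.sum_sdiff (Finset.subset_univ J)]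
  refine add_le_add ?_ ?_
  · calc _ ≤ ∑ _i ∈ Finset.univ \ J.image σ, (4 * r - 4) * m := Finset.sum_le_sum fun i _ => hNN _
      _ = ∑ _i ∈ Finset.univ \ J, (4 * r - 4) * m := by
        rw [Finset.sum_const, Finset.sum_const, hcard]
      _ = ∑ i ∈ Finset.univ \ J, val i := by
        refine Finset.sum_congr rfl fun i hi => ?_
        simp only [val, if_neg (Finset.mem_sdiff.1 hi).2]
  · rw [Finset.sum_image hinj]
    refine le_of_eq (Finset.sum_congr rfl fun i hi => ?_)
    simp only [val, if_pos hi]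

theorem Bal.whiteheadMinimal (hr : 2 ≤ r) {w : FreeGroup (Fin r)} (hw : CyclicallyReduced w)
    (hB : Bal w.toWord) : WhiteheadMinimal w := by
  intro α
  obtain ⟨u, hu, he⟩ := Nat.sInf_mem (s := len '' {u | IsConj u (α w)}) ⟨_, α w, IsConj.refl _, rfl⟩
  rw [conjMinLen, ← he]
  obtain ⟨c, hc⟩ := isConj_iff.1 (IsConj.symm hu)
  have := hB.len_le hr hw (α.trans (MulAut.conj c))
  simpa [hc] using this

end determ2

end part6

section part7
open FreeGroup

section counting
variable {r : ℕ}

/-- total weight of the consecutive pairs of a word -/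
def wt (f : Fin r × Bool → Fin r × Bool → ℝ) : List (Fin r × Bool) → ℝ
  | [] => 0
  | [_] => 0
  | x :: y :: l => f x y + wt f (y :: l)

/-- reduced continuations of `x` of a given length with large weight -/
def TS (f : Fin r × Bool → Fin r × Bool → ℝ) (n : ℕ) (x : Fin r × Bool) (c : ℝ) :
    Set (List (Fin r × Bool)) :=
  {L | L.length = n ∧ FreeGroup.IsReduced (x :: L) ∧ c ≤ wt f (x :: L)}

lemma TS_finite (f : Fin r × Bool → Fin r × Bool → ℝ) (n : ℕ) (x : Fin r × Bool) (c : ℝ) :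
    (TS f n x c).Finite := (List.finite_length_eq _ n).subset fun _ hL => hL.1

lemma TS_succ_subset (f : Fin r × Bool → Fin r × Bool → ℝ) (n : ℕ) (x : Fin r × Bool) (c : ℝ) :
    TS f (n + 1) x c ⊆ ⋃ y ∈ Finset.univ.erase (linv x), (fun L => y :: L) '' TS f n y (c - f x y) := by
  rintro L ⟨h1, h2, h3⟩
  rcases L with _ | ⟨y, L⟩
  · simp at h1
  · rw [FreeGroup.IsReduced, List.isChain_cons_cons, rel_iff] at h2
    simp only [Set.mem_iUnion]
    refine ⟨y, Finset.mem_erase.2 ⟨h2.1, Finset.mem_univ _⟩, L, ⟨by simpa using h1, h2.2, ?_⟩, rfl⟩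
    simp only [wt] at h3
    linarith

lemma TS_succ_ncard (f : Fin r × Bool → Fin r × Bool → ℝ) (n : ℕ) (x : Fin r × Bool) (c : ℝ) :
    (TS f (n + 1) x c).ncard ≤ ∑ y ∈ Finset.univ.erase (linv x), (TS f n y (c - f x y)).ncard := by
  refine (Set.ncard_le_ncard (TS_succ_subset f n x c) ?_).trans ?_
  · exact (Finset.finite_toSet _).biUnion fun y _ => (TS_finite _ _ _ _).image _
  · refine (Finset.set_ncard_biUnion_le _ _).trans (Finset.sum_le_sum fun y _ => ?_)
    exact Set.ncard_image_le (TS_finite _ _ _ _)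

lemma TS_bound (f : Fin r × Bool → Fin r × Bool → ℝ) (h : Fin r × Bool → ℝ) {θ H K : ℝ}
    (hθ : 0 ≤ θ) (hH : ∀ x, -H ≤ h x) (hK0 : 0 ≤ K)
    (hK : ∀ x, ∑ y ∈ Finset.univ.erase (linv x), Real.exp (θ * (f x y + h y - h x)) ≤ K)
    (n : ℕ) (x : Fin r × Bool) (c : ℝ) :
    ((TS f n x c).ncard : ℝ) ≤ K ^ n * Real.exp (θ * (h x + H - c)) := by
  induction n generalizing x c with
  | zero =>
    rw [pow_zero, one_mul]
    have hsub : TS f 0 x c ⊆ {[]} := fun L hL => by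
      have := hL.1
      rw [List.length_eq_zero_iff] at this
      exact this
    by_cases hc : c ≤ 0
    · have h1 := Set.ncard_le_ncard hsub
      rw [Set.ncard_singleton] at h1
      have h2 : (1 : ℝ) ≤ Real.exp (θ * (h x + H - c)) := by
        rw [Real.one_le_exp_iff]
        refine mul_nonneg hθ ?_
        have := hH x
        linarith
      have h3 : ((TS f 0 x c).ncard : ℝ) ≤ 1 := by exact_mod_cast h1
      linarith
    · have : TS f 0 x c = ∅ := by
        rw [Set.eq_empty_iff_forall_notMem]
        intro L hL
        have h1 := hsub hL
        rw [Set.mem_singleton_iff] at h1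
        subst h1
        exact hc hL.2.2
      rw [this]
      simp only [Set.ncard_empty, Nat.cast_zero]
      positivity
  | succ n ih =>
    have h1 : ((TS f (n + 1) x c).ncard : ℝ) ≤
        ∑ y ∈ Finset.univ.erase (linv x), ((TS f n y (c - f x y)).ncard : ℝ) := by
      exact_mod_cast TS_succ_ncard f n x c
    refine h1.trans ((Finset.sum_le_sum fun y _ => ih y (c - f x y)).trans ?_)
    have h2 : ∀ y, K ^ n * Real.exp (θ * (h y + H - (c - f x y))) =
        K ^ n * Real.exp (θ * (h x + H - c)) * Real.exp (θ * (f x y + h y - h x)) := by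
      intro y
      rw [mul_assoc, ← Real.exp_add]
      congr 2
      ring
    simp only [h2]
    rw [← Finset.mul_sum, pow_succ, mul_right_comm]
    rw [mul_right_comm, mul_right_comm (K ^ n) K]
    exact mul_le_mul_of_nonneg_left (hK x) (by positivity)

lemma sum_linv (g : Fin r × Bool → ℝ) : ∑ x, g (linv x) = ∑ x, g x := linv_bij.sum_comp g

lemma card_letters_s14 : (Finset.univ : Finset (Fin r × Bool)).card = 2 * r := by simp [mul_comm]

/-- the total of `f` over allowed pairs -/
def tot (f : Fin r × Bool → Fin r × Bool → ℝ) : ℝ := ∑ x, ∑ y ∈ Finset.univ.erase (linv x), f x y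

lemma card_erase' (hr : 2 ≤ r) (x : Fin r × Bool) :
    ((Finset.univ.erase x).card : ℝ) = 2 * r - 1 := by
  rw [Finset.card_erase_of_mem (Finset.mem_univ _), card_letters_s14, Nat.cast_sub (by omega)]
  push_cast; ring

lemma corrector (hr : 2 ≤ r) (f : Fin r × Bool → Fin r × Bool → ℝ) :
    ∃ h : Fin r × Bool → ℝ, ∀ x, ∑ y ∈ Finset.univ.erase (linv x), (f x y + h y - h x)
      = tot f / (2 * r) := by
  have hr' : (2 : ℝ) ≤ r := by exact_mod_cast hr
  set q : ℝ := 2 * r - 1 with hq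
  have hq3 : 3 ≤ q := by linarith
  have hq2 : q ^ 2 - 1 ≠ 0 := by nlinarith
  let F : Fin r × Bool → ℝ := fun x => ∑ y ∈ Finset.univ.erase (linv x), f x y
  let G : Fin r × Bool → ℝ := fun x => F x - tot f / (2 * r)
  have hG : ∑ x, G x = 0 := by
    simp only [G, Finset.sum_sub_distrib, Finset.sum_const, card_letters_s14]
    have : ∑ x, F x = tot f := rfl
    rw [this, nsmul_eq_mul]
    push_cast
    field_simp
    ring
  let h : Fin r × Bool → ℝ := fun x => (q * G x - G (linv x)) / (q ^ 2 - 1)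
  have hh : ∑ x, h x = 0 := by
    simp only [h]
    rw [← Finset.sum_div, Finset.sum_sub_distrib, ← Finset.mul_sum, sum_linv, hG]
    simp
  refine ⟨h, fun x => ?_⟩
  have e1 : ∑ y ∈ Finset.univ.erase (linv x), h y = - h (linv x) := by
    have := Finset.add_sum_erase Finset.univ h (Finset.mem_univ (linv x))
    rw [hh] at this
    linarith
  rw [Finset.sum_sub_distrib, Finset.sum_add_distrib, e1, Finset.sum_const, nsmul_eq_mul,
    card_erase' hr]
  have e2 : ∑ y ∈ Finset.univ.erase (linv x), f x y = G x + tot f / (2 * r) := by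
    simp only [G, F]; ring
  rw [e2]
  have e3 : q * h x + h (linv x) = G x := by
    simp only [h, linv_linv]
    field_simp
    ring
  rw [← hq]
  linarith

lemma exp_param (hr : 2 ≤ r) (f : Fin r × Bool → Fin r × Bool → ℝ) (hf : tot f < 0) :
    ∃ (h : Fin r × Bool → ℝ) (θ K : ℝ), 0 ≤ θ ∧ 1 ≤ K ∧ K < 2 * r - 1 ∧
      ∀ x, ∑ y ∈ Finset.univ.erase (linv x), Real.exp (θ * (f x y + h y - h x)) ≤ K := by
  obtain ⟨h, hh⟩ := corrector hr f
  have hr' : (2 : ℝ) ≤ r := by exact_mod_cast hr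
  set q : ℝ := 2 * r - 1 with hq
  have hq3 : 3 ≤ q := by linarith
  let g : (Fin r × Bool) × (Fin r × Bool) → ℝ := fun p => f p.1 p.2 + h p.2 - h p.1
  obtain ⟨M, hM1, hM⟩ : ∃ M : ℝ, 1 ≤ M ∧ ∀ p, |g p| ≤ M := by
    refine ⟨1 + ∑ p, |g p|, ?_, fun p => ?_⟩
    · have : 0 ≤ ∑ p, |g p| := Finset.sum_nonneg fun _ _ => abs_nonneg _
      linarith
    · have := Finset.single_le_sum (f := fun p => |g p|) (fun _ _ => abs_nonneg _) (Finset.mem_univ p)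
      linarith
  obtain ⟨δ, hδ0, hδ1, hδ⟩ : ∃ δ : ℝ, 0 < δ ∧ δ ≤ 1 ∧ tot f / (2 * r) ≤ - δ * q := by
    have hneg : 0 < - (tot f / (2 * r)) / q := by
      have : tot f / (2 * r) < 0 := div_neg_of_neg_of_pos hf (by linarith)
      exact div_pos (by linarith) (by linarith)
    refine ⟨min 1 (- (tot f / (2 * r)) / q), lt_min one_pos hneg, min_le_left _ _, ?_⟩
    have := min_le_right 1 (- (tot f / (2 * r)) / q)
    rw [le_div_iff₀ (by linarith)] at this
    linarith
  set θ : ℝ := δ / (2 * M ^ 2) with hθ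
  have hM2 : 1 ≤ M ^ 2 := by nlinarith
  have hθ0 : 0 < θ := by positivity
  have hθM : θ * M ≤ 1 := by
    rw [hθ, div_mul_eq_mul_div, div_le_one (by positivity)]
    nlinarith
  have hθM2 : θ * M ^ 2 = δ / 2 := by rw [hθ]; field_simp
  have hθ1 : θ ≤ 1 / 2 := by nlinarith
  refine ⟨h, θ, q * (1 - θ * δ / 2), hθ0.le, ?_, ?_, fun x => ?_⟩
  · have h1 : θ * δ ≤ 1 / 2 * 1 := mul_le_mul hθ1 hδ1 hδ0.le (by norm_num)
    have h2 : 3 * (3 / 4) ≤ q * (1 - θ * δ / 2) := mul_le_mul hq3 (by linarith) (by norm_num) (by linarith)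
    linarith
  · have : 0 < q * (θ * δ) := by positivity
    linarith
  · have hterm : ∀ y ∈ Finset.univ.erase (linv x), Real.exp (θ * (f x y + h y - h x)) ≤
        1 + θ * (f x y + h y - h x) + θ * (δ / 2) := by
      intro y _
      have hb : |f x y + h y - h x| ≤ M := hM (x, y)
      set t := f x y + h y - h x
      have h1 : |θ * t| ≤ 1 := by
        rw [abs_mul, abs_of_pos hθ0]
        exact (mul_le_mul_of_nonneg_left hb hθ0.le).trans hθM
      have h2 := (abs_le.1 (Real.abs_exp_sub_one_sub_id_le h1)).2
      have h3 : t ^ 2 ≤ M ^ 2 := by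
        rw [← sq_abs]; exact pow_le_pow_left₀ (abs_nonneg _) hb 2
      have h4 : (θ * t) ^ 2 ≤ θ * (δ / 2) := by
        rw [← hθM2]
        have : θ ^ 2 * t ^ 2 ≤ θ ^ 2 * M ^ 2 := mul_le_mul_of_nonneg_left h3 (by positivity)
        nlinarith
      linarith
    refine (Finset.sum_le_sum hterm).trans ?_
    rw [Finset.sum_add_distrib, Finset.sum_add_distrib, ← Finset.mul_sum, hh x, Finset.sum_const,
      Finset.sum_const, nsmul_eq_mul, nsmul_eq_mul, card_erase' hr, ← hq]
    have := mul_le_mul_of_nonneg_left hδ hθ0.le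
    linarith

/-- reduced words of length `n` -/
def RW (r n : ℕ) : Set (List (Fin r × Bool)) := {L | L.length = n ∧ FreeGroup.IsReduced L}

lemma drift_count (hr : 2 ≤ r) (f : Fin r × Bool → Fin r × Bool → ℝ) (hf : tot f < 0) (c : ℝ) :
    ∃ C K : ℝ, 0 ≤ C ∧ 1 ≤ K ∧ K < 2 * r - 1 ∧
      ∀ n, ({L | L ∈ RW r n ∧ c ≤ wt f L}.ncard : ℝ) ≤ C * K ^ n := by
  obtain ⟨h, θ, K, hθ, hK1, hKq, hK⟩ := exp_param hr f hf
  obtain ⟨H, hH⟩ : ∃ H : ℝ, ∀ x, -H ≤ h x := by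
    refine ⟨∑ x, |h x|, fun x => ?_⟩
    have := Finset.single_le_sum (f := fun p => |h p|) (fun _ _ => abs_nonneg _) (Finset.mem_univ x)
    have := neg_abs_le (h x)
    linarith
  refine ⟨1 + ∑ x, Real.exp (θ * (h x + H - c)), K, ?_, hK1, hKq, fun n => ?_⟩
  · positivity
  have hsn : 0 ≤ ∑ x, Real.exp (θ * (h x + H - c)) := by positivity
  rcases n with _ | n
  · have hsub : {L | L ∈ RW r 0 ∧ c ≤ wt f L} ⊆ {[]} := fun L hL => by
      have := hL.1.1
      rw [List.length_eq_zero_iff] at this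
      exact this
    have h1 := Set.ncard_le_ncard hsub
    rw [Set.ncard_singleton] at h1
    have h3 : (({L | L ∈ RW r 0 ∧ c ≤ wt f L}).ncard : ℝ) ≤ 1 := by exact_mod_cast h1
    rw [pow_zero]
    linarith
  · have hsub : {L | L ∈ RW r (n + 1) ∧ c ≤ wt f L} ⊆
        ⋃ x ∈ (Finset.univ : Finset (Fin r × Bool)), (fun L => x :: L) '' TS f n x c := by
      rintro L ⟨⟨h1, h2⟩, h3⟩
      rcases L with _ | ⟨x, L⟩
      · simp at h1
      · simp only [Set.mem_iUnion]
        exact ⟨x, Finset.mem_univ _, L, ⟨by simpa using h1, h2, h3⟩, rfl⟩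
    have h1 : {L | L ∈ RW r (n + 1) ∧ c ≤ wt f L}.ncard ≤ ∑ x, (TS f n x c).ncard := by
      refine (Set.ncard_le_ncard hsub ?_).trans ?_
      · exact (Finset.finite_toSet _).biUnion fun y _ => (TS_finite _ _ _ _).image _
      · refine (Finset.set_ncard_biUnion_le _ _).trans (Finset.sum_le_sum fun y _ => ?_)
        exact Set.ncard_image_le (TS_finite _ _ _ _)
    have h2 : (({L | L ∈ RW r (n + 1) ∧ c ≤ wt f L}).ncard : ℝ) ≤ ∑ x, ((TS f n x c).ncard : ℝ) := by
      exact_mod_cast h1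
    refine h2.trans ((Finset.sum_le_sum fun x _ =>
      TS_bound f h hθ hH (by linarith) hK n x c).trans ?_)
    rw [← Finset.mul_sum, mul_comm]
    have hpow : K ^ n ≤ K ^ (n + 1) := pow_le_pow_right₀ hK1 (by omega)
    refine mul_le_mul (by linarith) hpow (by positivity) (by linarith)

/-- the number of reduced continuations -/
lemma RW_le (hr : 2 ≤ r) (n : ℕ) : ((RW r n).ncard : ℝ) ≤ 2 * r * (2 * r - 1) ^ n := by
  have hr' : (2 : ℝ) ≤ r := by exact_mod_cast hr
  rcases n with _ | n
  · have hsub : RW r 0 ⊆ {[]} := fun L hL => by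
      have := hL.1
      rw [List.length_eq_zero_iff] at this
      exact this
    have h1 := Set.ncard_le_ncard hsub
    rw [Set.ncard_singleton] at h1
    have h3 : ((RW r 0).ncard : ℝ) ≤ 1 := by exact_mod_cast h1
    rw [pow_zero]
    linarith
  · have hsub : RW r (n + 1) ⊆
        ⋃ x ∈ (Finset.univ : Finset (Fin r × Bool)), (fun L => x :: L) '' TS (fun _ _ => 0) n x (-1) := by
      rintro L ⟨h1, h2⟩
      rcases L with _ | ⟨x, L⟩
      · simp at h1
      · simp only [Set.mem_iUnion]
        refine ⟨x, Finset.mem_univ _, L, ⟨by simpa using h1, h2, ?_⟩, rfl⟩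
        have : ∀ L : List (Fin r × Bool), wt (fun _ _ => 0) L = 0 := by
          intro L
          induction L with
          | nil => rfl
          | cons x L ih =>
            rcases L with _ | ⟨y, L⟩
            · rfl
            · simp only [wt, zero_add]; exact ih
        rw [this]; norm_num
    have h1 : (RW r (n + 1)).ncard ≤ ∑ x : Fin r × Bool, (TS (fun _ _ => 0) n x (-1)).ncard := by
      refine (Set.ncard_le_ncard hsub ?_).trans ?_
      · exact (Finset.finite_toSet _).biUnion fun y _ => (TS_finite _ _ _ _).image _
      · refine (Finset.set_ncard_biUnion_le _ _).trans (Finset.sum_le_sum fun y _ => ?_)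
        exact Set.ncard_image_le (TS_finite _ _ _ _)
    have h2 : ((RW r (n + 1)).ncard : ℝ) ≤ ∑ x : Fin r × Bool, ((TS (fun _ _ => 0) n x (-1)).ncard : ℝ) := by
      exact_mod_cast h1
    have hb : ∀ x : Fin r × Bool, ((TS (fun _ _ => 0) n x (-1)).ncard : ℝ) ≤ (2 * r - 1) ^ n := by
      intro x
      have := TS_bound (fun _ _ => 0) (fun _ => 0) (θ := 0) (H := 0) (K := 2 * r - 1) le_rfl (by simp)
        (by linarith) (fun x => by simp [card_erase' hr, Nat.cast_sub (show 1 ≤ r * 2 by omega)]; linarith)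
        n x (-1)
      simpa using this
    refine h2.trans ((Finset.sum_le_sum fun x _ => hb x).trans ?_)
    rw [Finset.sum_const, card_letters_s14, nsmul_eq_mul]
    push_cast
    have hpow : (2 * (r:ℝ) - 1) ^ n ≤ (2 * r - 1) ^ (n + 1) := pow_le_pow_right₀ (by linarith) (by omega)
    exact mul_le_mul_of_nonneg_left hpow (by linarith)

end counting

end part7

section part8
open FreeGroup

section small
variable {r : ℕ}

/-- exponentially small growth -/
def Small (B : Set (FreeGroup (Fin r))) : Prop :=
  ∃ C K : ℝ, 0 ≤ C ∧ 1 ≤ K ∧ K < 2 * r - 1 ∧ ∀ n, (sphereCount B n : ℝ) ≤ C * K ^ n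

lemma sphere_finite (B : Set (FreeGroup (Fin r))) (n : ℕ) : {w | w ∈ B ∧ len w = n}.Finite := by
  refine Set.Finite.of_finite_image (f := toWord) ?_ toWord_injective.injOn
  refine (List.finite_length_eq (Fin r × Bool) n).subset ?_
  rintro _ ⟨w, hw, rfl⟩
  exact hw.2

lemma ball_finite (B : Set (FreeGroup (Fin r))) (n : ℕ) : {w | w ∈ B ∧ len w ≤ n}.Finite := by
  refine Set.Finite.of_finite_image (f := toWord) ?_ toWord_injective.injOn
  refine (List.finite_length_le (Fin r × Bool) n).subset ?_
  rintro _ ⟨w, hw, rfl⟩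
  exact hw.2

lemma sphereCount_le {B : Set (FreeGroup (Fin r))} {n : ℕ} {S : Set (List (Fin r × Bool))}
    (hS : S.Finite) (h : ∀ w ∈ B, len w = n → w.toWord ∈ S) : sphereCount B n ≤ S.ncard := by
  rw [sphereCount, ← Set.ncard_image_of_injective _ toWord_injective]
  refine Set.ncard_le_ncard ?_ hS
  rintro _ ⟨w, hw, rfl⟩
  exact h w hw.1 hw.2

lemma sphereCount_mono {A B : Set (FreeGroup (Fin r))} (h : A ⊆ B) (n : ℕ) :
    sphereCount A n ≤ sphereCount B n :=
  Set.ncard_le_ncard (fun _ hw => ⟨h hw.1, hw.2⟩) (sphere_finite _ _)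

lemma Small.mono {A B : Set (FreeGroup (Fin r))} (hB : Small B) (h : A ⊆ B) : Small A := by
  obtain ⟨C, K, h0, h1, h2, h3⟩ := hB
  exact ⟨C, K, h0, h1, h2, fun n => le_trans (by exact_mod_cast sphereCount_mono h n) (h3 n)⟩

lemma Small.union {A B : Set (FreeGroup (Fin r))} (hA : Small A) (hB : Small B) : Small (A ∪ B) := by
  obtain ⟨C, K, h0, h1, h2, h3⟩ := hA
  obtain ⟨C', K', h0', h1', h2', h3'⟩ := hB
  refine ⟨C + C', max K K', by linarith, le_max_of_le_left h1, max_lt h2 h2', fun n => ?_⟩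
  have e : sphereCount (A ∪ B) n ≤ sphereCount A n + sphereCount B n := by
    refine le_trans (Set.ncard_le_ncard ?_ ((sphere_finite A n).union (sphere_finite B n)))
      (Set.ncard_union_le _ _)
    rintro w ⟨hw | hw, hl⟩
    · exact Or.inl ⟨hw, hl⟩
    · exact Or.inr ⟨hw, hl⟩
  have e' : (sphereCount (A ∪ B) n : ℝ) ≤ sphereCount A n + sphereCount B n := by exact_mod_cast e
  have p1 : K ^ n ≤ (max K K') ^ n := pow_le_pow_left₀ (by linarith) (le_max_left _ _) n
  have p2 : K' ^ n ≤ (max K K') ^ n := pow_le_pow_left₀ (by linarith) (le_max_right _ _) n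
  have q1 := mul_le_mul_of_nonneg_left p1 h0
  have q2 := mul_le_mul_of_nonneg_left p2 h0'
  have := h3 n; have := h3' n
  linarith

lemma Small.biUnion {ι : Type*} (s : Finset ι) (B : ι → Set (FreeGroup (Fin r))) (hr : 2 ≤ r)
    (h : ∀ i ∈ s, Small (B i)) : Small (⋃ i ∈ s, B i) := by
  classical
  induction s using Finset.induction_on with
  | empty =>
    refine ⟨0, 1, le_rfl, le_rfl, ?_, fun n => ?_⟩
    · have : (2 : ℝ) ≤ r := by exact_mod_cast hr
      linarith
    · simp [sphereCount]
  | insert a s ha ih =>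
    rw [Finset.set_biUnion_insert]
    exact (h a (by simp)).union (ih fun i hi => h i (by simp [hi]))

lemma absorb {K q : ℝ} (h1 : 1 ≤ K) (h2 : K < q) :
    ∃ C K' : ℝ, 0 ≤ C ∧ K ≤ K' ∧ K' < q ∧ ∀ n : ℕ, ((n : ℝ) + 1) * K ^ n ≤ C * K' ^ n := by
  have hK0 : 0 < K := by linarith
  set ρ : ℝ := (K + q) / 2 / K with hρ
  have hρ1 : 1 < ρ := by rw [hρ, lt_div_iff₀ hK0]; linarith
  have hK' : (K + q) / 2 = ρ * K := by rw [hρ]; field_simp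
  refine ⟨1 + 1 / (ρ - 1), (K + q) / 2, ?_, by linarith, by linarith, fun n => ?_⟩
  · have : 0 < 1 / (ρ - 1) := by apply one_div_pos.2; linarith
    linarith
  rw [hK', mul_pow, ← mul_assoc]
  refine mul_le_mul_of_nonneg_right ?_ (by positivity)
  have hb := one_add_mul_le_pow (a := ρ - 1) (by linarith) n
  rw [add_sub_cancel] at hb
  have h3 : (1 : ℝ) ≤ ρ ^ n := one_le_pow₀ hρ1.le
  have hpos : 0 < ρ - 1 := by linarith
  have h4 : (n : ℝ) ≤ 1 / (ρ - 1) * ρ ^ n := by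
    rw [div_mul_eq_mul_div, one_mul, le_div_iff₀ hpos]
    linarith
  linarith

/-- indicator weight of a pair -/
def ind (u v : Fin r × Bool) (x y : Fin r × Bool) : ℝ := if x = u ∧ y = v then 1 else 0

/-- linear count -/
def LAt (W : List (Fin r × Bool)) (x y : Fin r × Bool) (j : ℕ) : Prop :=
  W[j]? = some x ∧ W[j + 1]? = some y

instance (W : List (Fin r × Bool)) (x y : Fin r × Bool) : DecidablePred (LAt W x y) :=
  fun _ => inferInstanceAs (Decidable (_ ∧ _))

lemma wt_ind (u v : Fin r × Bool) (W : List (Fin r × Bool)) :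
    wt (ind u v) W = (Nat.count (LAt W u v) W.length : ℝ) := by
  induction W with
  | nil => simp [wt]
  | cons x W ih =>
    rcases W with _ | ⟨y, W⟩
    · simp [wt, Nat.count_succ, LAt]
    · rw [List.length_cons, Nat.count_succ', wt, ih]
      have : (fun k => LAt (x :: y :: W) u v (k + 1)) = LAt (y :: W) u v := by
        ext k; simp [LAt]
      have e : Nat.count (fun k => LAt (x :: y :: W) u v (k + 1)) (y :: W).length =
          Nat.count (LAt (y :: W) u v) (y :: W).length := by congr!
      rw [e]
      push_cast
      rw [add_comm]
      congr 1
      simp [ind, LAt]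

lemma lin_cyc (u v : Fin r × Bool) (W : List (Fin r × Bool)) :
    wt (ind u v) W ≤ cc W u v ∧ (cc W u v : ℝ) ≤ wt (ind u v) W + 1 := by
  rw [wt_ind]
  rcases W with _ | ⟨x, W⟩
  · simp [cc]
  · rw [cc, List.length_cons, Nat.count_succ, Nat.count_succ]
    have e : Nat.count (At (x :: W) u v) W.length = Nat.count (LAt (x :: W) u v) W.length := by
      rw [Nat.count_eq_card_filter_range, Nat.count_eq_card_filter_range]
      congr 1
      refine Finset.filter_congr fun j hj => ?_
      rw [Finset.mem_range] at hj
      rw [At, LAt, Nat.mod_eq_of_lt, Nat.mod_eq_of_lt] <;> simp <;> omega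
    rw [e]
    have e2 : ¬ LAt (x :: W) u v W.length := by simp [LAt]
    rw [if_neg e2]
    split_ifs <;> constructor <;> push_cast <;> linarith

lemma wt_add (f g : Fin r × Bool → Fin r × Bool → ℝ) (W : List (Fin r × Bool)) :
    wt (fun x y => f x y + g x y) W = wt f W + wt g W := by
  induction W with
  | nil => simp [wt]
  | cons x W ih =>
    rcases W with _ | ⟨y, W⟩
    · simp [wt]
    · simp only [wt]; rw [ih]; ring

lemma wt_smul (a : ℝ) (f : Fin r × Bool → Fin r × Bool → ℝ) (W : List (Fin r × Bool)) :
    wt (fun x y => a * f x y) W = a * wt f W := by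
  induction W with
  | nil => simp [wt]
  | cons x W ih =>
    rcases W with _ | ⟨y, W⟩
    · simp [wt]
    · simp only [wt]; rw [ih]; ring

lemma tot_add (f g : Fin r × Bool → Fin r × Bool → ℝ) :
    tot (fun x y => f x y + g x y) = tot f + tot g := by
  simp [tot, Finset.sum_add_distrib]

lemma tot_smul (a : ℝ) (f : Fin r × Bool → Fin r × Bool → ℝ) :
    tot (fun x y => a * f x y) = a * tot f := by
  simp only [tot, Finset.mul_sum]

lemma tot_ind {u v : Fin r × Bool} (h : v ≠ linv u) : tot (ind u v) = 1 := by
  unfold tot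
  rw [Finset.sum_eq_single u]
  · rw [Finset.sum_eq_single v]
    · simp [ind]
    · intro b _ hb; simp [ind, hb]
    · intro hv; exact absurd (Finset.mem_erase.2 ⟨h, Finset.mem_univ _⟩) hv
  · intro b _ hb
    exact Finset.sum_eq_zero fun y _ => by simp [ind, hb]
  · simp

/-- the comparison weight of two turns -/
def cmp4 (a b c d : Fin r × Bool) (x y : Fin r × Bool) : ℝ :=
  (3 * ind (linv a) b x y + 3 * ind (linv b) a x y) + (-4 * ind (linv c) d x y + -4 * ind (linv d) c x y)

lemma tot_cmp4 {a b c d : Fin r × Bool} (hab : a ≠ b) (hcd : c ≠ d) : tot (cmp4 a b c d) = -2 := by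
  unfold cmp4
  rw [tot_add, tot_add (fun x y => 3 * ind (linv a) b x y), tot_add (fun x y => -4 * ind (linv c) d x y)]
  simp only [tot_smul]
  rw [tot_ind (by rw [linv_linv]; exact hab.symm), tot_ind (by rw [linv_linv]; exact hab),
    tot_ind (by rw [linv_linv]; exact hcd.symm), tot_ind (by rw [linv_linv]; exact hcd)]
  norm_num

lemma wt_cmp4 {a b c d : Fin r × Bool} {W : List (Fin r × Bool)} (h : 4 * tt W c d < 3 * tt W a b) :
    -6 ≤ wt (cmp4 a b c d) W := by
  unfold cmp4
  rw [wt_add, wt_add (fun x y => 3 * ind (linv a) b x y), wt_add (fun x y => -4 * ind (linv c) d x y)]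
  simp only [wt_smul]
  have h1 := (lin_cyc (linv a) b W).2
  have h2 := (lin_cyc (linv b) a W).2
  have h3 := (lin_cyc (linv c) d W).1
  have h4 := (lin_cyc (linv d) c W).1
  have h5 : (4 : ℝ) * (cc W (linv c) d + cc W (linv d) c) ≤ 3 * (cc W (linv a) b + cc W (linv b) a) := by
    have := h.le
    simp only [tt] at this
    exact_mod_cast this
  linarith

lemma RW_finite (n : ℕ) : (RW r n).Finite := (List.finite_length_eq _ n).subset fun _ hL => hL.1

lemma small_not_bal (hr : 2 ≤ r) : Small {w : FreeGroup (Fin r) | ¬ Bal w.toWord} := by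
  classical
  let I := (Fin r × Bool) × (Fin r × Bool) × (Fin r × Bool) × (Fin r × Bool)
  let s : Finset I := Finset.univ.filter fun p => p.1 ≠ p.2.1 ∧ p.2.2.1 ≠ p.2.2.2
  let B : I → Set (FreeGroup (Fin r)) := fun p =>
    {w | 4 * tt w.toWord p.2.2.1 p.2.2.2 < 3 * tt w.toWord p.1 p.2.1}
  refine Small.mono (Small.biUnion s B hr fun p hp => ?_) ?_
  · simp only [s, Finset.mem_filter, Finset.mem_univ, true_and] at hp
    obtain ⟨C, K, h0, h1, h2, h3⟩ := drift_count hr (cmp4 p.1 p.2.1 p.2.2.1 p.2.2.2)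
      (by rw [tot_cmp4 hp.1 hp.2]; norm_num) (-6)
    refine ⟨C, K, h0, h1, h2, fun n => le_trans ?_ (h3 n)⟩
    rw [Nat.cast_le]
    refine sphereCount_le ((RW_finite n).subset fun L hL => hL.1) fun w hw hl => ?_
    exact ⟨⟨hl, isReduced_toWord⟩, wt_cmp4 hw⟩
  · intro w hw
    simp only [Set.mem_ofPred_eq, Bal] at hw
    push Not at hw
    obtain ⟨a, b, c, d, hab, hcd, hlt⟩ := hw
    simp only [Set.mem_iUnion]
    exact ⟨(a, b, c, d), by simp [s, hab, hcd], hlt⟩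

end small

end part8

section part9
open FreeGroup

section final
variable {r : ℕ}

lemma power_word {w u : FreeGroup (Fin r)} (hw : CyclicallyReduced w) {k : ℕ} (hk : 2 ≤ k)
    (h : w = u ^ k) :
    w.toWord = (List.replicate k (reduceCyclically u.toWord)).flatten := by
  have e := toWord_pow u k
  rw [reduceCyclically.reduce_flatten_replicate isReduced_toWord, if_neg (by omega), ← h] at e
  rcases hc : reduceCyclically.conjugator u.toWord with _ | ⟨a, t⟩
  · rw [hc] at e; simpa using e
  · exfalso
    rw [hc] at e
    refine hw a ?_ (a.1, !a.2) ?_ ?_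
    · rw [e]; simp
    · rw [e, List.getLast?_append]; simp [invRev]
    · simp

lemma small_power (hr : 2 ≤ r) :
    Small {w : FreeGroup (Fin r) | CyclicallyReduced w ∧ ProperPower w} := by
  have hr' : (2 : ℝ) ≤ r := by exact_mod_cast hr
  set q : ℝ := 2 * r - 1 with hq
  have hq3 : 3 ≤ q := by linarith
  have hs1 : 1 ≤ Real.sqrt q := Real.one_le_sqrt.2 (by linarith)
  have hss : Real.sqrt q * Real.sqrt q = q := Real.mul_self_sqrt (by linarith)
  have hs2 : Real.sqrt q < q := by nlinarith
  obtain ⟨C, K, hC, hK, hKq, hCK⟩ := absorb hs1 hs2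
  refine ⟨2 * r * C, K, by positivity, by linarith, hKq, fun n => ?_⟩
  have hsub : ∀ w ∈ {w : FreeGroup (Fin r) | CyclicallyReduced w ∧ ProperPower w}, len w = n →
      w.toWord ∈ ⋃ d ∈ Finset.range (n / 2 + 1),
        (fun L => (List.replicate (n / d) L).flatten) '' RW r d := by
    rintro w ⟨hw, u, k, hk, he⟩ hl
    have hword := power_word hw hk he
    have hlen : n = k * (reduceCyclically u.toWord).length := by
      rw [← hl, len, hword]; simp
    set d := (reduceCyclically u.toWord).length with hd
    have hdn : 2 * d ≤ n := by rw [hlen]; exact Nat.mul_le_mul_right _ hk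
    simp only [Set.mem_iUnion]
    refine ⟨d, by rw [Finset.mem_range]; omega, reduceCyclically u.toWord,
      ⟨hd.symm, (reduceCyclically.isCyclicallyReduced isReduced_toWord).isReduced⟩, ?_⟩
    rw [hword]
    rcases Nat.eq_zero_or_pos d with h0 | h0
    · have : reduceCyclically u.toWord = [] := List.length_eq_zero_iff.1 (hd.symm.trans h0)
      simp [this]
    · simp only [hlen, Nat.mul_div_cancel _ h0]
  have hfin : (⋃ d ∈ Finset.range (n / 2 + 1),
        (fun L : List (Fin r × Bool) => (List.replicate (n / d) L).flatten) '' RW r d).Finite :=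
    (Finset.finite_toSet _).biUnion fun d _ => (RW_finite d).image _
  have h1 := sphereCount_le hfin hsub
  have h2 := h1.trans ((Finset.set_ncard_biUnion_le _ _).trans
    (Finset.sum_le_sum fun d _ => Set.ncard_image_le (RW_finite d)))
  have h3 : (sphereCount {w : FreeGroup (Fin r) | CyclicallyReduced w ∧ ProperPower w} n : ℝ) ≤
      ∑ d ∈ Finset.range (n / 2 + 1), ((RW r d).ncard : ℝ) := by exact_mod_cast h2
  refine h3.trans ?_
  have h4 : ∀ d ∈ Finset.range (n / 2 + 1), ((RW r d).ncard : ℝ) ≤ 2 * r * Real.sqrt q ^ n := by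
    intro d hd
    rw [Finset.mem_range] at hd
    refine (RW_le hr d).trans (mul_le_mul_of_nonneg_left ?_ (by linarith))
    have e : q ^ d = Real.sqrt q ^ (2 * d) := by rw [pow_mul, pow_two, hss]
    rw [← hq, e]
    exact pow_le_pow_right₀ hs1 (by omega)
  refine (Finset.sum_le_sum h4).trans ?_
  rw [Finset.sum_const, Finset.card_range, nsmul_eq_mul]
  have h5 : ((n / 2 + 1 : ℕ) : ℝ) ≤ n + 1 := by
    have : n / 2 + 1 ≤ n + 1 := by omega
    exact_mod_cast this
  have h6 : 0 ≤ 2 * r * Real.sqrt q ^ n := by positivity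
  have h7 := mul_le_mul_of_nonneg_right h5 h6
  have h8 := mul_le_mul_of_nonneg_left (hCK n) (show (0 : ℝ) ≤ 2 * r by linarith)
  linarith

/-- the bad cyclically reduced elements -/
def BadC (r : ℕ) : Set (FreeGroup (Fin r)) :=
  {w | CyclicallyReduced w ∧ ¬ (¬ ProperPower w ∧ WhiteheadMinimal w)}

lemma small_badC (hr : 2 ≤ r) : Small (BadC r) := by
  refine ((small_power hr).union (small_not_bal hr)).mono ?_
  rintro w ⟨hw, h⟩
  by_contra hcon
  simp only [Set.mem_union, Set.mem_ofPred_eq, not_or, not_not, not_and] at hcon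
  exact h ⟨hcon.1 hw, Bal.whiteheadMinimal hr hw hcon.2⟩

/-- the bad elements -/
def BadF (r : ℕ) : Set (FreeGroup (Fin r)) :=
  {w | ¬ (¬ ProperPower w ∧ ∃ c : FreeGroup (Fin r), IsCyclicReduction c w ∧ WhiteheadMinimal c)}

lemma decomp {w : FreeGroup (Fin r)} (hw : w ∈ BadF r) :
    ∃ g c : FreeGroup (Fin r), c ∈ BadC r ∧ w = g * c * g⁻¹ ∧ 2 * len g + len c = len w := by
  have e := reduceCyclically.conj_conjugator_reduceCyclically w.toWord
  set G := reduceCyclically.conjugator w.toWord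
  set c0 := reduceCyclically w.toWord with hc0
  have hcyc : IsCyclicallyReduced c0 := reduceCyclically.isCyclicallyReduced isReduced_toWord
  have hred : FreeGroup.IsReduced (G ++ c0 ++ invRev G) := by rw [e]; exact isReduced_toWord
  have hGred : FreeGroup.IsReduced G := by
    rw [List.append_assoc] at hred
    exact (List.isChain_append.1 hred).1
  have hwe : w = mk G * mk c0 * (mk G)⁻¹ := by
    rw [inv_mk, mul_mk, mul_mk, e, mk_toWord]
  have hcw : (mk c0).toWord = c0 := toWord_mk_red hcyc.isReduced
  have hCR : CyclicallyReduced (mk c0) := by rw [cyc_iff, hcw]; exact hcyc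
  refine ⟨mk G, mk c0, ⟨hCR, fun hgood => hw ⟨?_, ?_⟩⟩, hwe, ?_⟩
  · rintro ⟨u, k, hk, hu⟩
    refine hgood.1 ⟨(mk G)⁻¹ * u * mk G, k, hk, ?_⟩
    have : (mk G)⁻¹ * u * mk G = (mk G)⁻¹ * u * ((mk G)⁻¹)⁻¹ := by simp
    rw [this, conj_pow, ← hu, hwe]
    group
  · exact ⟨mk c0, ⟨hCR, mk G, hwe⟩, hgood.2⟩
  · have := congrArg List.length e
    rw [List.length_append, List.length_append, invRev_length] at this
    rw [len, len, len, hcw, toWord_mk_red hGred]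
    omega

lemma small_badF (hr : 2 ≤ r) : Small (BadF r) := by
  have hr' : (2 : ℝ) ≤ r := by exact_mod_cast hr
  set q : ℝ := 2 * r - 1 with hq
  have hq3 : 3 ≤ q := by linarith
  have hs1 : 1 ≤ Real.sqrt q := Real.one_le_sqrt.2 (by linarith)
  have hss : Real.sqrt q * Real.sqrt q = q := Real.mul_self_sqrt (by linarith)
  have hs2 : Real.sqrt q < q := by nlinarith
  obtain ⟨C, K0, hC, hK1, hKq, hCK⟩ := small_badC hr
  set K := max K0 (Real.sqrt q) with hKdef
  have hK1' : 1 ≤ K := le_max_of_le_left hK1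
  have hKq' : K < q := max_lt hKq hs2
  have hqK : q ≤ K ^ 2 := by
    rw [← hss, pow_two]
    exact mul_self_le_mul_self (by linarith) (le_max_right _ _)
  have hb : ∀ n, (sphereCount (BadC r) n : ℝ) ≤ C * K ^ n := fun n =>
    (hCK n).trans (mul_le_mul_of_nonneg_left (pow_le_pow_left₀ (by linarith) (le_max_left _ _) n) hC)
  obtain ⟨C', K', hC', hK', hKq'', hCK'⟩ := absorb hK1' hKq'
  refine ⟨2 * r * C * C', K', by positivity, by linarith, hKq'', fun n => ?_⟩
  let S : ℕ → Set (FreeGroup (Fin r) × FreeGroup (Fin r)) := fun k =>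
    {g | g ∈ Set.univ ∧ len g = k} ×ˢ {c | c ∈ BadC r ∧ len c = n - 2 * k}
  have hSf : ∀ k, (S k).Finite := fun k => (sphere_finite _ _).prod (sphere_finite _ _)
  have hsub : {w | w ∈ BadF r ∧ len w = n} ⊆ ⋃ k ∈ Finset.range (n / 2 + 1),
      (fun p : FreeGroup (Fin r) × FreeGroup (Fin r) => p.1 * p.2 * p.1⁻¹) '' S k := by
    rintro w ⟨hw, hl⟩
    obtain ⟨g, c, hc, he, hlen⟩ := decomp hw
    simp only [Set.mem_iUnion]
    refine ⟨len g, by rw [Finset.mem_range]; omega, (g, c), ⟨⟨trivial, rfl⟩, hc, by show len c = _; omega⟩, he.symm⟩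
  have h1 : sphereCount (BadF r) n ≤ ∑ k ∈ Finset.range (n / 2 + 1), (S k).ncard := by
    refine (Set.ncard_le_ncard hsub ?_).trans ((Finset.set_ncard_biUnion_le _ _).trans
      (Finset.sum_le_sum fun d _ => Set.ncard_image_le (hSf d)))
    exact (Finset.finite_toSet _).biUnion fun d _ => (hSf d).image _
  have h3 : (sphereCount (BadF r) n : ℝ) ≤ ∑ k ∈ Finset.range (n / 2 + 1), ((S k).ncard : ℝ) := by
    exact_mod_cast h1
  refine h3.trans ?_
  have h4 : ∀ k ∈ Finset.range (n / 2 + 1), ((S k).ncard : ℝ) ≤ 2 * r * C * K ^ n := by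
    intro k hk
    rw [Finset.mem_range] at hk
    have e1 : ((S k).ncard : ℝ) = sphereCount (Set.univ : Set (FreeGroup (Fin r))) k *
        sphereCount (BadC r) (n - 2 * k) := by
      simp only [S, Set.ncard_prod, sphereCount, Nat.cast_mul]
    have e2 : (sphereCount (Set.univ : Set (FreeGroup (Fin r))) k : ℝ) ≤ 2 * r * q ^ k := by
      refine le_trans ?_ (RW_le hr k)
      rw [Nat.cast_le]
      exact sphereCount_le (RW_finite k) fun w _ hl => ⟨hl, isReduced_toWord⟩
    have e3 : q ^ k ≤ K ^ (2 * k) := by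
      rw [pow_mul]; exact pow_le_pow_left₀ (by linarith) hqK k
    have e4 : (sphereCount (Set.univ : Set (FreeGroup (Fin r))) k : ℝ) ≤ 2 * r * K ^ (2 * k) :=
      e2.trans (mul_le_mul_of_nonneg_left e3 (by linarith))
    rw [e1]
    refine (mul_le_mul e4 (hb _) (by positivity) (by positivity)).trans (le_of_eq ?_)
    have : K ^ n = K ^ (2 * k) * K ^ (n - 2 * k) := by rw [← pow_add]; congr 1; omega
    rw [this]; ring
  refine (Finset.sum_le_sum h4).trans ?_
  rw [Finset.sum_const, Finset.card_range, nsmul_eq_mul]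
  have h5 : ((n / 2 + 1 : ℕ) : ℝ) ≤ n + 1 := by
    have : n / 2 + 1 ≤ n + 1 := by omega
    exact_mod_cast this
  have h6 : 0 ≤ 2 * r * C * K ^ n := by positivity
  have h7 := mul_le_mul_of_nonneg_right h5 h6
  have h8 := mul_le_mul_of_nonneg_left (hCK' n) (show (0 : ℝ) ≤ 2 * r * C by positivity)
  linarith

/-- reduced continuations, as a finset -/
def RL : ℕ → Fin r × Bool → Finset (List (Fin r × Bool))
  | 0, _ => {[]}
  | n + 1, x => (Finset.univ.erase (linv x)).biUnion fun y => (RL n y).image fun L => y :: L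

lemma RL_card (n : ℕ) (x : Fin r × Bool) : (RL n x).card = (2 * r - 1) ^ n := by
  induction n generalizing x with
  | zero => simp [RL]
  | succ n ih =>
    rw [RL, Finset.card_biUnion]
    · have : ∀ y, ((RL n y).image fun L => y :: L).card = (2 * r - 1) ^ n := fun y => by
        rw [Finset.card_image_of_injective _ (fun a b h => by simpa using h), ih]
      simp only [this, Finset.sum_const, Finset.card_erase_of_mem (Finset.mem_univ _), card_letters_s14]
      rw [smul_eq_mul, pow_succ, mul_comm]
    · intro y _ z _ hyz
      rw [Function.onFun, Finset.disjoint_left]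
      intro L h1 h2
      rw [Finset.mem_image] at h1 h2
      obtain ⟨L1, -, rfl⟩ := h1
      obtain ⟨L2, -, h⟩ := h2
      simp only [List.cons.injEq] at h
      exact hyz h.1.symm

lemma RL_mem (n : ℕ) (x : Fin r × Bool) (L : List (Fin r × Bool)) (h : L ∈ RL n x) :
    L.length = n ∧ FreeGroup.IsReduced (x :: L) := by
  induction n generalizing x L with
  | zero => simp [RL] at h; simp [h]
  | succ n ih =>
    simp only [RL, Finset.mem_biUnion, Finset.mem_image] at h
    obtain ⟨y, hy, L', hL', rfl⟩ := h
    obtain ⟨h1, h2⟩ := ih y L' hL'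
    refine ⟨by simp [h1], ?_⟩
    rw [FreeGroup.IsReduced, List.isChain_cons_cons, rel_iff]
    exact ⟨Finset.ne_of_mem_erase hy, h2⟩

lemma cyc_lower (hr : 2 ≤ r) (n : ℕ) :
    (2 * r - 1) ^ n ≤ sphereCount {w : FreeGroup (Fin r) | CyclicallyReduced w} (n + 2) := by
  classical
  let x : Fin r × Bool := (⟨0, by omega⟩, true)
  have hz : ∀ L : List (Fin r × Bool), ∃ z, z ≠ linv x ∧ ∀ y ∈ (x :: L).getLast?, z ≠ linv y := by
    intro L
    let y := (x :: L).getLast (by simp)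
    have hcard : ({linv x, linv y} : Finset (Fin r × Bool)).card < (Finset.univ : Finset (Fin r × Bool)).card := by
      rw [card_letters_s14]
      exact lt_of_le_of_lt Finset.card_le_two (by omega)
    obtain ⟨z, -, hz⟩ := Finset.exists_mem_notMem_of_card_lt_card hcard
    simp only [Finset.mem_insert, Finset.mem_singleton, not_or] at hz
    refine ⟨z, hz.1, fun y' hy' => ?_⟩
    rw [List.getLast?_eq_some_getLast (by simp)] at hy'
    simp only [Option.mem_def, Option.some.injEq] at hy'
    rw [← hy']; exact hz.2
  choose z hz1 hz2 using hz
  have hred : ∀ L ∈ RL n x, FreeGroup.IsReduced ((x :: L) ++ [z L]) := by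
    intro L hL
    rw [FreeGroup.IsReduced, List.isChain_append]
    refine ⟨(RL_mem n x L hL).2, List.isChain_singleton _, fun y hy t ht => ?_⟩
    simp only [List.head?_cons, Option.mem_def, Option.some.injEq] at ht
    rw [rel_iff, ← ht]
    exact hz2 L y hy
  rw [← RL_card n x, ← Set.ncard_coe_finset]
  refine Set.ncard_le_ncard_of_injOn (fun L => mk ((x :: L) ++ [z L])) ?_ ?_ (sphere_finite _ _)
  · intro L hL
    have hw := toWord_mk_red (hred L hL)
    refine ⟨?_, ?_⟩
    · show CyclicallyReduced _
      rw [cyc_iff, hw, isCyclicallyReduced_cons_append_iff]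
      refine ⟨hred L hL, (rel_iff _ _).2 ?_⟩
      intro h
      apply hz1 L
      rw [h, linv_linv]
    · rw [len, hw]; simp [(RL_mem n x L hL).1]
  · intro L hL L' hL' h
    have h1 := congrArg toWord h
    simp only at h1
    rw [toWord_mk_red (hred L hL), toWord_mk_red (hred L' hL')] at h1
    have h2 := (List.append_inj' h1 rfl).1
    simpa using h2

lemma ball_lower (hr : 2 ≤ r) {D : Set (FreeGroup (Fin r))} (hD : {w | CyclicallyReduced w} ⊆ D)
    (n : ℕ) (hn : 2 ≤ n) : (2 * (r : ℝ) - 1) ^ n ≤ (2 * r - 1) ^ 2 * ballCount D n := by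
  obtain ⟨k, rfl⟩ := Nat.exists_eq_add_of_le hn
  have h1 : sphereCount {w : FreeGroup (Fin r) | CyclicallyReduced w} (k + 2) ≤ ballCount D (2 + k) :=
    Set.ncard_le_ncard (fun w hw => ⟨hD hw.1, by have := hw.2; omega⟩) (ball_finite _ _)
  have h2 := (cyc_lower hr k).trans h1
  have h3 : (((2 * r - 1) ^ k : ℕ) : ℝ) ≤ ballCount D (2 + k) := by exact_mod_cast h2
  rw [Nat.cast_pow, Nat.cast_sub (by omega)] at h3
  push_cast at h3
  rw [pow_add]
  exact mul_le_mul_of_nonneg_left h3 (by positivity)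

lemma expGeneric_of_small (hr : 2 ≤ r) {A D : Set (FreeGroup (Fin r))}
    (hD : {w | CyclicallyReduced w} ⊆ D) (hA : A ⊆ D) (hS : Small (D \ A)) : ExpGeneric A D := by
  have hr' : (2 : ℝ) ≤ r := by exact_mod_cast hr
  set q : ℝ := 2 * r - 1 with hq
  have hq3 : 3 ≤ q := by linarith
  obtain ⟨C0, K0, hC0, hK0, hKq0, hCK0⟩ := hS
  obtain ⟨C1, K, hC1, hK, hKq, hCK⟩ := absorb hK0 hKq0
  have hK1 : 1 ≤ K := by linarith
  have hKpos : 0 < K := by linarith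
  have hqpos : 0 < q := by linarith
  set C := C0 * C1 + 1 with hC
  have hCpos : 0 < C := by positivity
  have hball : ∀ n, (ballCount (D \ A) n : ℝ) ≤ C * K ^ n := by
    intro n
    have hsub : {w | w ∈ D \ A ∧ len w ≤ n} ⊆ ⋃ k ∈ Finset.range (n + 1), {w | w ∈ D \ A ∧ len w = k} := by
      rintro w ⟨hw, hl⟩
      simp only [Set.mem_iUnion]
      exact ⟨len w, by rw [Finset.mem_range]; omega, hw, rfl⟩
    have h1 : ballCount (D \ A) n ≤ ∑ k ∈ Finset.range (n + 1), sphereCount (D \ A) k := by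
      refine (Set.ncard_le_ncard hsub ?_).trans (Finset.set_ncard_biUnion_le _ _)
      exact (Finset.finite_toSet _).biUnion fun d _ => sphere_finite _ _
    have h2 : (ballCount (D \ A) n : ℝ) ≤ ∑ k ∈ Finset.range (n + 1), (sphereCount (D \ A) k : ℝ) := by
      exact_mod_cast h1
    have h3 : ∀ k ∈ Finset.range (n + 1), (sphereCount (D \ A) k : ℝ) ≤ C0 * K0 ^ n := by
      intro k hk
      rw [Finset.mem_range] at hk
      exact (hCK0 k).trans (mul_le_mul_of_nonneg_left (pow_le_pow_right₀ hK0 (by omega)) hC0)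
    refine h2.trans ((Finset.sum_le_sum h3).trans ?_)
    rw [Finset.sum_const, Finset.card_range, nsmul_eq_mul]
    push_cast
    have h4 := mul_le_mul_of_nonneg_left (hCK n) hC0
    have h5 : 0 ≤ K ^ n := by positivity
    rw [hC]
    linarith
  have hlog : 0 < Real.log (q / K) := Real.log_pos (by rw [lt_div_iff₀ hKpos]; linarith)
  refine ⟨Real.log (q / K), hlog, Real.log (C * q ^ 2), 2, fun n hn => ?_⟩
  have hexp : Real.exp (Real.log (C * q ^ 2) - Real.log (q / K) * n) = C * q ^ 2 * K ^ n / q ^ n := by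
    rw [Real.exp_sub, Real.exp_log (by positivity), mul_comm (Real.log _), Real.exp_nat_mul,
      Real.exp_log (by positivity), div_pow]
    field_simp
  rw [hexp]
  have hlow := ball_lower hr hD n hn
  rw [← hq] at hlow
  have hqn : 0 < q ^ n := by positivity
  have hDpos : (0 : ℝ) < ballCount D n := by
    by_contra hcon
    have : q ^ 2 * (ballCount D n : ℝ) ≤ 0 := mul_nonpos_of_nonneg_of_nonpos (by positivity) (not_lt.1 hcon)
    linarith
  have hsum : (ballCount D n : ℝ) = ballCount A n + ballCount (D \ A) n := by
    have : ballCount D n = ballCount A n + ballCount (D \ A) n := by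
      rw [ballCount, ballCount, ballCount, ← Set.ncard_union_eq _ (ball_finite _ _) (ball_finite _ _)]
      · congr 1
        ext w
        simp only [Set.mem_ofPred_eq, Set.mem_union, Set.mem_sdiff]
        constructor
        · rintro ⟨h1, h2⟩
          by_cases h : w ∈ A
          · exact Or.inl ⟨h, h2⟩
          · exact Or.inr ⟨⟨h1, h⟩, h2⟩
        · rintro (⟨h1, h2⟩ | ⟨⟨h1, -⟩, h2⟩)
          · exact ⟨hA h1, h2⟩
          · exact ⟨h1, h2⟩
      · rw [Set.disjoint_left]
        rintro w h1 h2
        exact h2.1.2 h1.1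
    exact_mod_cast this
  rw [le_div_iff₀ hDpos, sub_mul, one_mul]
  have h1 : (ballCount (D \ A) n : ℝ) ≤ C * q ^ 2 * K ^ n / q ^ n * ballCount D n := by
    rw [div_mul_eq_mul_div, le_div_iff₀ hqn]
    have h2 := mul_le_mul (hball n) hlow hqn.le (by positivity)
    linarith
  linarith

theorem main_result (hr : 2 ≤ r) :
    ExpGeneric
      {w : FreeGroup (Fin r) | CyclicallyReduced w ∧ ¬ ProperPower w ∧ WhiteheadMinimal w}
      {w : FreeGroup (Fin r) | CyclicallyReduced w} ∧
    ExpGeneric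
      {w : FreeGroup (Fin r) | ¬ ProperPower w ∧
        ∃ c : FreeGroup (Fin r), IsCyclicReduction c w ∧ WhiteheadMinimal c}
      (Set.univ : Set (FreeGroup (Fin r))) := by
  constructor
  · refine expGeneric_of_small hr subset_rfl (fun w hw => hw.1) ((small_badC hr).mono ?_)
    rintro w ⟨h1, h2⟩
    exact ⟨h1, fun h => h2 ⟨h1, h⟩⟩
  · refine expGeneric_of_small hr (Set.subset_univ _) (Set.subset_univ _) ((small_badF hr).mono ?_)
    rintro w ⟨-, h2⟩
    exact h2

end final

end part9

/-- cyclically reduced, non-proper-power, Whitehead minimal elements are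
exponentially generic in `C`; and non-proper-power elements whose cyclic reduction is
Whitehead minimal are exponentially generic in `F`. -/
theorem whiteheadMinimal_expGeneric {r : ℕ} (hr : 2 ≤ r) :
    ExpGeneric
      {w : FreeGroup (Fin r) | CyclicallyReduced w ∧ ¬ ProperPower w ∧ WhiteheadMinimal w}
      {w : FreeGroup (Fin r) | CyclicallyReduced w} ∧
    ExpGeneric
      {w : FreeGroup (Fin r) | ¬ ProperPower w ∧
        ∃ c : FreeGroup (Fin r), IsCyclicReduction c w ∧ WhiteheadMinimal c}
      (Set.univ : Set (FreeGroup (Fin r))) := by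
  exact main_result hr

end VG
end
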